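/- arXiv:1902.10986 — 6 statements merged into one kernel-verified Lean document; each statement's English description precedes it below -/
import Mathlib

section
/- Let B be a basis of a Banach space X over 𝔽 and let w be a weight such that sup_n wₙ = ∞ or Σ_n wₙ < ∞. If B is C_sg-w-semi-greedy or C_sd-w-disjoint-super-democratic, then B is equivalent to the canonical basis of c₀. -/
open scoped BigOperators NNReal

noncomputable section

/-- A semi-normalized strong Markushevich basis of a space `X` over `𝕜`. -/
structure MBasis (𝕜 : Type*) [RCLike 𝕜] (X : Type*) [NormedAddCommGroup X]
    [NormedSpace 𝕜 X] where
  /-- the basis vectors -/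
  e : ℕ → X
  /-- the biorthogonal functionals -/
  f : ℕ → X →L[𝕜] 𝕜
  /-- a positive lower bound for the norms: `c₁ = inf_n min (‖e n‖, ‖f n‖)` -/
  c₁ : ℝ
  /-- an upper bound for the norms: `c₂ = sup_n max (‖e n‖, ‖f n‖)` -/
  c₂ : ℝ
  c₁_pos : 0 < c₁
  c₁_le_e : ∀ n, c₁ ≤ ‖e n‖
  c₁_le_f : ∀ n, c₁ ≤ ‖f n‖
  e_le_c₂ : ∀ n, ‖e n‖ ≤ c₂
  f_le_c₂ : ∀ n, ‖f n‖ ≤ c₂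
  biorth : ∀ j i, f j (e i) = if j = i then 1 else 0
  dense_span : closure (Submodule.span 𝕜 (Set.range e) : Set X) = Set.univ
  total : ∀ x : X, (∀ j, f j x = 0) → x = 0
  strong : ∀ A : Set ℕ,
    closure (Submodule.span 𝕜 (e '' A) : Set X) = {x : X | ∀ j ∉ A, f j x = 0}

namespace MBasis

variable {𝕜 : Type*} [RCLike 𝕜] {X : Type*} [NormedAddCommGroup X] [NormedSpace 𝕜 X]

/-- A sign is a family of scalars of modulus one. -/
def IsSign (ε : ℕ → 𝕜) : Prop := ∀ n, ‖ε n‖ = 1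

/-- `w(A) = Σ_{i ∈ A} w i` for a weight `w`. -/
def wSum (w : ℕ → ℝ) (A : Finset ℕ) : ℝ := ∑ i ∈ A, w i

/-- The projection `P_A x = Σ_{n ∈ A} eₙ*(x) eₙ`. -/
def proj (b : MBasis 𝕜 X) (A : Finset ℕ) (x : X) : X := ∑ n ∈ A, b.f n x • b.e n

/-- `1_{εA} = Σ_{n ∈ A} εₙ eₙ`. -/
def indic (b : MBasis 𝕜 X) (ε : ℕ → 𝕜) (A : Finset ℕ) : X := ∑ n ∈ A, ε n • b.e n

/-- `Λ` is a greedy set of `x`: coefficients inside dominate those outside. -/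
def IsGreedySet (b : MBasis 𝕜 X) (x : X) (Λ : Finset ℕ) : Prop :=
  ∀ n ∈ Λ, ∀ k, k ∉ Λ → ‖b.f k x‖ ≤ ‖b.f n x‖

/-- `B` is a Schauder basis with basis constant (at most) `K`. -/
def SchauderConst (b : MBasis 𝕜 X) (K : ℝ) : Prop :=
  ∀ m : ℕ, ∀ x : X, ‖∑ j ∈ Finset.range m, b.f j x • b.e j‖ ≤ K * ‖x‖

/-- `B` is `C`-quasi-greedy. -/
def QuasiGreedy (b : MBasis 𝕜 X) (C : ℝ) : Prop :=
  ∀ x : X, ∀ Λ : Finset ℕ, b.IsGreedySet x Λ → ‖x - b.proj Λ x‖ ≤ C * ‖x‖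

/-- `B` is `C`-`w`-almost-greedy. -/
def WAlmostGreedy (b : MBasis 𝕜 X) (w : ℕ → ℝ) (C : ℝ) : Prop :=
  ∀ x : X, ∀ Λ : Finset ℕ, b.IsGreedySet x Λ →
    ∀ A : Finset ℕ, wSum w A ≤ wSum w Λ →
      ‖x - b.proj Λ x‖ ≤ C * ‖x - b.proj A x‖

/-- `B` is `C`-`w`-super-democratic. -/
def WSuperDemocratic (b : MBasis 𝕜 X) (w : ℕ → ℝ) (C : ℝ) : Prop :=
  ∀ A B : Finset ℕ, wSum w A ≤ wSum w B →
    ∀ ε ε' : ℕ → 𝕜, IsSign ε → IsSign ε' →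
      ‖b.indic ε A‖ ≤ C * ‖b.indic ε' B‖

/-- `B` is `C`-`w`-disjoint-super-democratic. -/
def WDisjSuperDemocratic (b : MBasis 𝕜 X) (w : ℕ → ℝ) (C : ℝ) : Prop :=
  ∀ A B : Finset ℕ, Disjoint A B → wSum w A ≤ wSum w B →
    ∀ ε ε' : ℕ → 𝕜, IsSign ε → IsSign ε' →
      ‖b.indic ε A‖ ≤ C * ‖b.indic ε' B‖

/-- `B` is `C`-`w`-democratic. -/
def WDemocratic (b : MBasis 𝕜 X) (w : ℕ → ℝ) (C : ℝ) : Prop :=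
  ∀ A B : Finset ℕ, wSum w A ≤ wSum w B →
    ‖∑ n ∈ A, b.e n‖ ≤ C * ‖∑ n ∈ B, b.e n‖

/-- `B` is `C`-`w`-semi-greedy: the Chebyshev greedy approximant supported on any greedy
set `Λ` does as well, up to the constant `C`, as any approximant supported on a set `A`
with `w(A) ≤ w(Λ)`. -/
def WSemiGreedy (b : MBasis 𝕜 X) (w : ℕ → ℝ) (C : ℝ) : Prop :=
  ∀ x : X, ∀ Λ : Finset ℕ, b.IsGreedySet x Λ →
    ∀ A : Finset ℕ, wSum w A ≤ wSum w Λ → ∀ a : ℕ → 𝕜,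
      ∃ z ∈ Submodule.span 𝕜 (b.e '' (Λ : Set ℕ)),
        ‖x - z‖ ≤ C * ‖x - ∑ n ∈ A, a n • b.e n‖

/-- `B` is `C`-super-democratic (unweighted). -/
def SuperDemocratic (b : MBasis 𝕜 X) (C : ℝ) : Prop :=
  ∀ A B : Finset ℕ, A.card ≤ B.card →
    ∀ ε ε' : ℕ → 𝕜, IsSign ε → IsSign ε' →
      ‖b.indic ε A‖ ≤ C * ‖b.indic ε' B‖

/-- `B` is `C`-disjoint-super-democratic (unweighted). -/
def DisjSuperDemocratic (b : MBasis 𝕜 X) (C : ℝ) : Prop :=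
  ∀ A B : Finset ℕ, Disjoint A B → A.card ≤ B.card →
    ∀ ε ε' : ℕ → 𝕜, IsSign ε → IsSign ε' →
      ‖b.indic ε A‖ ≤ C * ‖b.indic ε' B‖

/-- `B` is `C`-semi-greedy (unweighted). -/
def SemiGreedy (b : MBasis 𝕜 X) (C : ℝ) : Prop :=
  ∀ x : X, ∀ Λ : Finset ℕ, b.IsGreedySet x Λ →
    ∀ A : Finset ℕ, A.card ≤ Λ.card → ∀ a : ℕ → 𝕜,
      ∃ z ∈ Submodule.span 𝕜 (b.e '' (Λ : Set ℕ)),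
        ‖x - z‖ ≤ C * ‖x - ∑ n ∈ A, a n • b.e n‖

/-- `B` is `ρ`-admissible. -/
def RhoAdmissible (b : MBasis 𝕜 X) (ρ : ℝ) : Prop :=
  ∀ A : Finset ℕ, ∃ n₀ : ℕ, ∀ B : Finset ℕ, (∀ n ∈ B, n₀ ≤ n) → B.card ≤ A.card →
    ∀ α : ℕ → 𝕜, ‖∑ n ∈ A, α n • b.e n‖ ≤ ρ * ‖∑ n ∈ A ∪ B, α n • b.e n‖

/-- `B` has the `C`-Property (C). -/
def PropertyC (b : MBasis 𝕜 X) (C : ℝ) : Prop :=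
  ∀ x : X, ∀ G : Finset ℕ, b.IsGreedySet x G → ∀ hG : G.Nonempty,
    ∀ ε : ℕ → 𝕜, IsSign ε →
      (G.inf' hG fun j => ‖b.f j x‖) * ‖b.indic ε G‖ ≤ C * ‖x‖

/-- `B` is equivalent to the canonical basis of `c₀`. -/
def EquivC0 (b : MBasis 𝕜 X) : Prop :=
  ∃ c C : ℝ, 0 < c ∧ c ≤ C ∧ ∀ A : Finset ℕ, ∀ a : ℕ → 𝕜,
    c * (↑(A.sup fun n => ‖a n‖₊) : ℝ) ≤ ‖∑ n ∈ A, a n • b.e n‖ ∧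
      ‖∑ n ∈ A, a n • b.e n‖ ≤ C * (↑(A.sup fun n => ‖a n‖₊) : ℝ)

/-- The subsequence `(e (σ k))_k` is equivalent to the canonical basis of `c₀`. -/
def SubseqEquivC0 (b : MBasis 𝕜 X) (σ : ℕ → ℕ) : Prop :=
  ∃ c C : ℝ, 0 < c ∧ c ≤ C ∧ ∀ F : Finset ℕ, ∀ a : ℕ → 𝕜,
    c * (↑(F.sup fun k => ‖a k‖₊) : ℝ) ≤ ‖∑ k ∈ F, a k • b.e (σ k)‖ ∧
      ‖∑ k ∈ F, a k • b.e (σ k)‖ ≤ C * (↑(F.sup fun k => ‖a k‖₊) : ℝ)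

end MBasis

open Classical in
/-- `κ = 1` if `𝕜 = ℝ` and `κ = 2` if `𝕜 = ℂ` (detected by whether `I = 0`). -/
noncomputable def kappa (𝕜 : Type*) [RCLike 𝕜] : ℝ :=
  if (RCLike.I : 𝕜) = 0 then 1 else 2


variable {𝕜 : Type*} [RCLike 𝕜] {X : Type*} [NormedAddCommGroup X] [NormedSpace 𝕜 X]
  [CompleteSpace X]

open MBasis

theorem aux_c2_pos (b : MBasis 𝕜 X) : 0 < b.c₂ :=
  b.c₁_pos.trans_le ((b.c₁_le_e 0).trans (b.e_le_c₂ 0))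

theorem aux_coeff (b : MBasis 𝕜 X) (A : Finset ℕ) (a : ℕ → 𝕜) (k : ℕ) :
    b.f k (∑ n ∈ A, a n • b.e n) = if k ∈ A then a k else 0 := by
  rw [map_sum]
  simp [b.biorth]

theorem aux_f_le (b : MBasis 𝕜 X) (k : ℕ) (x : X) : ‖b.f k x‖ ≤ b.c₂ * ‖x‖ :=
  ((b.f k).le_opNorm x).trans (mul_le_mul_of_nonneg_right (b.f_le_c₂ k) (norm_nonneg x))

theorem aux_convex (b : MBasis 𝕜 X) (A : Finset ℕ) (M : ℝ)
    (hM : ∀ ε : ℕ → 𝕜, IsSign ε → ‖b.indic ε A‖ ≤ M) (a : ℕ → 𝕜)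
    (ha : ∀ n ∈ A, ‖a n‖ ≤ 1) : ‖∑ n ∈ A, a n • b.e n‖ ≤ M := by
  obtain ⟨g, hg1, hg2⟩ := exists_dual_vector'' 𝕜 (∑ n ∈ A, a n • b.e n)
  have key : ∀ n, ∃ u : 𝕜, ‖u‖ = 1 ∧ u * g (b.e n) = ((‖g (b.e n)‖ : ℝ) : 𝕜) := by
    intro n
    by_cases h0 : g (b.e n) = 0
    · exact ⟨1, by simp, by simp [h0]⟩
    · refine ⟨((‖g (b.e n)‖ : ℝ) : 𝕜) / g (b.e n), ?_, ?_⟩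
      · rw [norm_div, RCLike.norm_ofReal, abs_norm, div_self (norm_ne_zero_iff.2 h0)]
      · exact div_mul_cancel₀ _ h0
  choose ε hε1 hε2 using key
  have h1 : g (b.indic ε A) = ((∑ n ∈ A, ‖g (b.e n)‖ : ℝ) : 𝕜) := by
    unfold MBasis.indic
    rw [map_sum, RCLike.ofReal_sum]
    refine Finset.sum_congr rfl fun n _ => ?_
    rw [map_smul, smul_eq_mul, hε2]
  have h2 : ∑ n ∈ A, ‖g (b.e n)‖ ≤ M := by
    have h3 : ‖g (b.indic ε A)‖ = ∑ n ∈ A, ‖g (b.e n)‖ := by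
      rw [h1, RCLike.norm_ofReal, abs_of_nonneg (Finset.sum_nonneg fun _ _ => norm_nonneg _)]
    rw [← h3]
    calc ‖g (b.indic ε A)‖ ≤ ‖g‖ * ‖b.indic ε A‖ := g.le_opNorm _
      _ ≤ 1 * ‖b.indic ε A‖ := mul_le_mul_of_nonneg_right hg1 (norm_nonneg _)
      _ ≤ M := by rw [one_mul]; exact hM ε hε1
  have h4 : ‖∑ n ∈ A, a n • b.e n‖ = ‖g (∑ n ∈ A, a n • b.e n)‖ := by
    rw [hg2, RCLike.norm_ofReal, abs_norm]
  rw [h4, map_sum]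
  refine (norm_sum_le _ _).trans (le_trans (Finset.sum_le_sum fun n hn => ?_) h2)
  rw [map_smul, smul_eq_mul, norm_mul]
  exact mul_le_of_le_one_left (norm_nonneg _) (ha n hn)

theorem aux_single (b : MBasis 𝕜 X) (w : ℕ → ℝ) (Csg Csd : ℝ)
    (h : b.WSemiGreedy w Csg ∨ b.WDisjSuperDemocratic w Csd) :
    ∃ K : ℝ, 0 ≤ K ∧ ∀ (A : Finset ℕ) (m : ℕ), m ∉ A → wSum w A ≤ w m → ∀ a : ℕ → 𝕜,
      (∀ n ∈ A, ‖a n‖ ≤ 1) → ‖∑ n ∈ A, a n • b.e n‖ ≤ K := by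
  have hc2 := aux_c2_pos b
  rcases h with h | h
  · refine ⟨|Csg| * b.c₂ + b.c₂ * (|Csg| * b.c₂) * b.c₂, by positivity, ?_⟩
    intro A m hm hwA a ha
    set y := ∑ n ∈ A, a n • b.e n with hy
    have hgr : b.IsGreedySet (y + b.e m) {m} := by
      intro n hn k hk
      rw [Finset.mem_singleton] at hn hk
      subst hn
      rw [map_add, map_add, hy, aux_coeff, aux_coeff, b.biorth, b.biorth, if_neg hk, if_neg hm]
      by_cases hkA : k ∈ A
      · simpa [hkA] using ha k hkA
      · simp [hkA]
    obtain ⟨z, hz, hle⟩ := h (y + b.e m) {m} hgr A (by simpa [MBasis.wSum] using hwA) a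
    rw [Finset.coe_singleton, Set.image_singleton, Submodule.mem_span_singleton] at hz
    obtain ⟨t, rfl⟩ := hz
    rw [← hy, add_sub_cancel_left] at hle
    have hle2 : ‖y + b.e m - t • b.e m‖ ≤ |Csg| * b.c₂ :=
      hle.trans (mul_le_mul (le_abs_self _) (b.e_le_c₂ m) (norm_nonneg _) (abs_nonneg _))
    have hf : b.f m (y + b.e m - t • b.e m) = 1 - t := by
      rw [map_sub, map_add, map_smul, hy, aux_coeff, b.biorth]
      simp [hm]
    have ht : ‖1 - t‖ ≤ b.c₂ * (|Csg| * b.c₂) := by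
      rw [← hf]
      exact (aux_f_le b m _).trans (mul_le_mul_of_nonneg_left hle2 hc2.le)
    have hyeq : y = (y + b.e m - t • b.e m) - (1 - t) • b.e m := by
      rw [sub_smul, one_smul]; abel
    calc ‖y‖ = ‖(y + b.e m - t • b.e m) - (1 - t) • b.e m‖ := by rw [← hyeq]
      _ ≤ ‖y + b.e m - t • b.e m‖ + ‖(1 - t) • b.e m‖ := norm_sub_le _ _
      _ ≤ _ := by
        rw [norm_smul]
        exact add_le_add hle2 (mul_le_mul ht (b.e_le_c₂ m) (norm_nonneg _) (by positivity))
  · refine ⟨|Csd| * b.c₂, by positivity, ?_⟩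
    intro A m hm hwA a ha
    refine aux_convex b A _ (fun ε hε => ?_) a ha
    have := h A {m} (by simpa using hm) (by simpa [MBasis.wSum] using hwA) ε (fun _ => 1) hε
      (fun _ => by simp)
    refine this.trans (mul_le_mul (le_abs_self _) ?_ (norm_nonneg _) (abs_nonneg _))
    simpa [MBasis.indic] using b.e_le_c₂ m

theorem aux_all (b : MBasis 𝕜 X) (w : ℕ → ℝ) (hw : ∀ n, 0 < w n)
    (hw' : ¬ BddAbove (Set.range w) ∨ Summable w) (Csg Csd : ℝ)
    (h : b.WSemiGreedy w Csg ∨ b.WDisjSuperDemocratic w Csd) :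
    ∃ K : ℝ, 0 ≤ K ∧ ∀ (A : Finset ℕ) (a : ℕ → 𝕜),
      (∀ n ∈ A, ‖a n‖ ≤ 1) → ‖∑ n ∈ A, a n • b.e n‖ ≤ K := by
  have hc2 := aux_c2_pos b
  obtain ⟨K, hK0, hK⟩ := aux_single b w Csg Csd h
  rcases hw' with hb | hs
  · refine ⟨K, hK0, fun A a ha => ?_⟩
    rw [not_bddAbove_iff] at hb
    obtain ⟨_, ⟨m, rfl⟩, hm⟩ := hb (wSum w A)
    refine hK A m (fun hmA => ?_) hm.le a ha
    exact absurd (Finset.single_le_sum (f := w) (fun i _ => (hw i).le) hmA) (not_le.2 hm)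
  · obtain ⟨s, hs'⟩ := (summable_iff_vanishing_norm.1 hs) (w 0) (hw 0)
    refine ⟨(insert 0 s).card * b.c₂ + K, by positivity, fun A a ha => ?_⟩
    rw [← Finset.sum_inter_add_sum_sdiff A (insert 0 s)]
    refine (norm_add_le _ _).trans (add_le_add ?_ ?_)
    · calc _ ≤ ∑ n ∈ A ∩ insert 0 s, ‖a n • b.e n‖ := norm_sum_le _ _
        _ ≤ ∑ n ∈ A ∩ insert 0 s, b.c₂ := by
          refine Finset.sum_le_sum fun n hn => ?_
          rw [norm_smul]
          exact (mul_le_of_le_one_left (norm_nonneg _) (ha n (Finset.mem_inter.1 hn).1)).trans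
            (b.e_le_c₂ n)
        _ = (A ∩ insert 0 s).card * b.c₂ := by rw [Finset.sum_const, nsmul_eq_mul]
        _ ≤ _ := by
          have := Finset.card_le_card (Finset.inter_subset_right (s₁ := A) (s₂ := insert 0 s))
          gcongr
    · refine hK _ 0 (by simp) ?_ a (fun n hn => ha n (Finset.mem_sdiff.1 hn).1)
      refine (le_abs_self _).trans (hs' _ ?_).le
      rw [Finset.disjoint_left]
      intro n hn hns
      exact (Finset.mem_sdiff.1 hn).2 (Finset.mem_insert_of_mem hns)

/-- If `sup wₙ = ∞` or `Σ wₙ < ∞`, and `B` is `w`-semi-greedy or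
`w`-disjoint-super-democratic, then `B` is equivalent to the canonical basis of `c₀`. -/
theorem stmt9 (b : MBasis 𝕜 X) (w : ℕ → ℝ) (hw : ∀ n, 0 < w n)
    (hw' : ¬ BddAbove (Set.range w) ∨ Summable w) (Csg Csd : ℝ)
    (h : b.WSemiGreedy w Csg ∨ b.WDisjSuperDemocratic w Csd) :
    b.EquivC0 := by
  have hc2 := aux_c2_pos b
  obtain ⟨K, hK0, hK⟩ := aux_all b w hw hw' Csg Csd h
  refine ⟨b.c₂⁻¹, max K b.c₂⁻¹, inv_pos.2 hc2, le_max_right _ _, fun A a => ⟨?_, ?_⟩⟩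
  · rw [inv_mul_le_iff₀ hc2]
    have : (A.sup fun n => ‖a n‖₊) ≤ (b.c₂ * ‖∑ n ∈ A, a n • b.e n‖).toNNReal := by
      refine Finset.sup_le fun n hn => ?_
      rw [← NNReal.coe_le_coe, Real.coe_toNNReal _ (by positivity), coe_nnnorm]
      have := aux_f_le b n (∑ n ∈ A, a n • b.e n)
      rwa [aux_coeff, if_pos hn] at this
    rw [← NNReal.coe_le_coe, Real.coe_toNNReal _ (by positivity)] at this
    exact this
  · set s := A.sup fun n => ‖a n‖₊ with hs
    have hle : ∀ n ∈ A, ‖a n‖ ≤ (s : ℝ) := fun n hn => by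
      have : ‖a n‖₊ ≤ s := Finset.le_sup (f := fun n => ‖a n‖₊) hn
      exact_mod_cast this
    refine le_trans ?_ (mul_le_mul_of_nonneg_right (le_max_left _ _) s.coe_nonneg)
    rcases eq_or_lt_of_le s.coe_nonneg with h0 | h0
    · have : ∑ n ∈ A, a n • b.e n = 0 := by
        refine Finset.sum_eq_zero fun n hn => ?_
        have := hle n hn
        rw [← h0] at this
        rw [norm_le_zero_iff.1 this, zero_smul]
      rw [this, norm_zero]
      positivity
    · have h1 := hK A (fun n => (((s : ℝ) : 𝕜))⁻¹ * a n) (fun n hn => by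
        rw [norm_mul, norm_inv, RCLike.norm_ofReal, abs_of_pos h0, inv_mul_le_iff₀ h0, mul_one]
        exact hle n hn)
      simp only [mul_smul] at h1
      rw [← Finset.smul_sum, norm_smul, norm_inv, RCLike.norm_ofReal, abs_of_pos h0,
        inv_mul_le_iff₀ h0] at h1
      rwa [mul_comm]
end
end

section
/- Let B be a basis of a Banach space X over 𝔽 and let w be a weight with inf_n wₙ = 0. If B is C_sg-w-semi-greedy or C_sd-w-disjoint-super-democratic, then B contains a subsequence (e_{n_k})_k equivalent to the canonical basis of c₀. -/
open scoped BigOperators NNReal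

noncomputable section

variable {𝕜 : Type*} [RCLike 𝕜] {X : Type*} [NormedAddCommGroup X] [NormedSpace 𝕜 X]
  [CompleteSpace X]

open MBasis

theorem key_bound {𝕜 : Type*} [RCLike 𝕜] {X : Type*} [NormedAddCommGroup X] [NormedSpace 𝕜 X]
    (b : MBasis 𝕜 X) (w : ℕ → ℝ) (Csg Csd : ℝ)
    (h : b.WSemiGreedy w Csg ∨ b.WDisjSuperDemocratic w Csd) :
    ∃ M : ℝ, ∀ A : Finset ℕ, 0 ∉ A → wSum w A ≤ w 0 → ∀ ε : ℕ → 𝕜, IsSign ε →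
      ‖b.indic ε A‖ ≤ M := by
  rcases h with h | h
  · refine ⟨Csg * ‖b.e 0‖ + ‖b.f 0‖ * (Csg * ‖b.e 0‖) * ‖b.e 0‖, fun A h0 hA ε hε => ?_⟩
    have hf : ∀ k, b.f k (b.indic ε A) = if k ∈ A then ε k else 0 := by
      intro k
      simp [MBasis.indic, map_sum, b.biorth]
    obtain ⟨z, hz, hle⟩ := h (b.indic ε A + b.e 0) {0} (by
      intro n hn k hk
      simp only [Finset.mem_singleton] at hn hk
      subst hn
      rw [map_add, map_add, hf, hf, b.biorth, b.biorth]
      by_cases hkA : k ∈ A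
      · simp [hkA, hk, h0, hε k]
      · simp [hkA, hk, h0]) A (by simpa [wSum] using hA) ε
    simp only [Finset.coe_singleton, Set.image_singleton, Submodule.mem_span_singleton] at hz
    obtain ⟨t, rfl⟩ := hz
    have e1 : b.indic ε A + b.e 0 - ∑ n ∈ A, ε n • b.e n = b.e 0 := by
      simp [MBasis.indic]
    rw [e1] at hle
    set y := b.indic ε A + b.e 0 - t • b.e 0 with hy
    have h1 : b.f 0 y = 1 - t := by
      rw [hy, map_sub, map_add, hf, map_smul, b.biorth]
      simp [h0]
    have h2 : ‖(1 : 𝕜) - t‖ ≤ ‖b.f 0‖ * (Csg * ‖b.e 0‖) := by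
      rw [← h1]
      exact (b.f 0).le_opNorm_of_le hle
    have h3 : b.indic ε A = y - (1 - t) • b.e 0 := by
      rw [hy, sub_smul, one_smul]; abel
    rw [h3]
    refine (norm_sub_le _ _).trans (add_le_add hle ?_)
    rw [norm_smul]
    exact mul_le_mul_of_nonneg_right h2 (norm_nonneg _)
  · refine ⟨Csd * ‖b.e 0‖, fun A h0 hA ε hε => ?_⟩
    have := h A {0} (by simpa using h0) (by simpa [wSum] using hA) ε (fun _ => 1) hε
      (fun _ => by simp)
    simpa [MBasis.indic] using this

theorem choose_sub (w : ℕ → ℝ) (hw : ∀ n, 0 < w n) (hw' : (⨅ n, w n) = 0) :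
    ∃ σ : ℕ → ℕ, StrictMono σ ∧ (∀ k, σ k ≠ 0) ∧
      ∀ F : Finset ℕ, ∑ k ∈ F, w (σ k) ≤ w 0 := by
  have hN : ∀ N : ℕ, ∀ δ : ℝ, 0 < δ → ∃ n, N ≤ n ∧ w n < δ := by
    intro N
    induction N with
    | zero =>
      intro δ hδ
      obtain ⟨n, hn⟩ := exists_lt_of_ciInf_lt (hw'.trans_lt hδ)
      exact ⟨n, Nat.zero_le _, hn⟩
    | succ N ih =>
      intro δ hδ
      obtain ⟨n, hn, hn'⟩ := ih (min δ (w N)) (lt_min hδ (hw N))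
      refine ⟨n, ?_, hn'.trans_le (min_le_left _ _)⟩
      rcases hn.eq_or_lt with rfl | h
      · exact absurd (hn'.trans_le (min_le_right _ _)) (lt_irrefl _)
      · exact h
  obtain ⟨σ, hσ, hP⟩ := Filter.extraction_forall_of_frequently
    (P := fun n k => k ≠ 0 ∧ w k < w 0 / 2 / 2 ^ n) (by
      intro n
      rw [Filter.frequently_atTop]
      intro a
      obtain ⟨k, hk, hk'⟩ := hN (a + 1) (w 0 / 2 / 2 ^ n) (by have := hw 0; positivity)
      exact ⟨k, by omega, by omega, hk'⟩)
  refine ⟨σ, hσ, fun k => (hP k).1, fun F => ?_⟩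
  calc ∑ k ∈ F, w (σ k) ≤ ∑ k ∈ F, w 0 / 2 / 2 ^ k :=
        Finset.sum_le_sum fun k _ => (hP k).2.le
    _ ≤ ∑' k : ℕ, w 0 / 2 / 2 ^ k :=
        (summable_geometric_two' (w 0)).sum_le_tsum F
          (fun k _ => by have := hw 0; positivity)
    _ = w 0 := tsum_geometric_two' (w 0)

/-- If `inf wₙ = 0` and `B` is `w`-semi-greedy or `w`-disjoint-super-democratic, then `B`
contains a subsequence equivalent to the canonical basis of `c₀`. -/
theorem stmt10 (b : MBasis 𝕜 X) (w : ℕ → ℝ) (hw : ∀ n, 0 < w n)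
    (hw' : (⨅ n, w n) = 0) (Csg Csd : ℝ)
    (h : b.WSemiGreedy w Csg ∨ b.WDisjSuperDemocratic w Csd) :
    ∃ σ : ℕ → ℕ, StrictMono σ ∧ b.SubseqEquivC0 σ := by
  obtain ⟨M, hM⟩ := key_bound b w Csg Csd h
  obtain ⟨σ, hσ, h0, hsum⟩ := choose_sub w hw hw'
  have hc₂ : 0 < b.c₂ := b.c₁_pos.trans_le ((b.c₁_le_e 0).trans (b.e_le_c₂ 0))
  refine ⟨σ, hσ, b.c₂⁻¹, max M b.c₂⁻¹, inv_pos.2 hc₂, le_max_right _ _, fun F a => ⟨?_, ?_⟩⟩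
  · rw [inv_mul_le_iff₀ hc₂]
    have hnn : F.sup (fun k => ‖a k‖₊) ≤
        (NNReal.mk b.c₂ hc₂.le) * ‖∑ k ∈ F, a k • b.e (σ k)‖₊ := by
      refine Finset.sup_le fun k hk => ?_
      have h1 : b.f (σ k) (∑ j ∈ F, a j • b.e (σ j)) = a k := by
        simp [map_sum, b.biorth, hσ.injective.eq_iff, hk]
      rw [← NNReal.coe_le_coe]
      have := (b.f (σ k)).le_of_opNorm_le (b.f_le_c₂ (σ k)) (∑ j ∈ F, a j • b.e (σ j))
      rw [h1] at this
      exact this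
    exact_mod_cast hnn
  · obtain ⟨g, hg, hgx⟩ := exists_dual_vector'' 𝕜 (∑ k ∈ F, a k • b.e (σ k))
    set S : ℝ := (↑(F.sup fun k => ‖a k‖₊) : ℝ) with hS
    have hS0 : 0 ≤ S := NNReal.coe_nonneg _
    have haS : ∀ k ∈ F, ‖a k‖ ≤ S := by
      intro k hk
      have : ‖a k‖₊ ≤ F.sup fun k => ‖a k‖₊ := Finset.le_sup (f := fun k => ‖a k‖₊) hk
      exact_mod_cast this
    have hex : ∀ n : ℕ, ∃ u : 𝕜, ‖u‖ = 1 ∧ u * g (b.e n) = (‖g (b.e n)‖ : 𝕜) := by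
      intro n
      by_cases hz : g (b.e n) = 0
      · exact ⟨1, by simp, by simp [hz]⟩
      · have hz' : (‖g (b.e n)‖ : 𝕜) ≠ 0 := by simpa using hz
        refine ⟨(‖g (b.e n)‖ : 𝕜) / g (b.e n), ?_, div_mul_cancel₀ _ hz⟩
        rw [norm_div, RCLike.norm_ofReal, abs_norm, div_self (norm_ne_zero_iff.2 hz)]
    choose ε hε hεg using hex
    have hA := hM (F.image σ) (by simpa using fun k _ => h0 k) (by
      rw [wSum, Finset.sum_image (fun _ _ _ _ h => hσ.injective h)]
      exact hsum F) ε hε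
    have hgsum : ∑ k ∈ F, ‖g (b.e (σ k))‖ ≤ M := by
      have h1 : g (b.indic ε (F.image σ)) = ((∑ k ∈ F, ‖g (b.e (σ k))‖ : ℝ) : 𝕜) := by
        rw [MBasis.indic, Finset.sum_image (fun _ _ _ _ h => hσ.injective h)]
        simp [map_sum, hεg]
      have h2 := g.le_of_opNorm_le hg (b.indic ε (F.image σ))
      rw [h1, RCLike.norm_ofReal, one_mul] at h2
      exact (le_abs_self _).trans (h2.trans hA)
    have hx : ‖∑ k ∈ F, a k • b.e (σ k)‖ = ‖g (∑ k ∈ F, a k • b.e (σ k))‖ := by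
      rw [hgx, RCLike.norm_ofReal, abs_norm]
    rw [hx, map_sum]
    calc ‖∑ k ∈ F, g (a k • b.e (σ k))‖ ≤ ∑ k ∈ F, S * ‖g (b.e (σ k))‖ := by
          refine norm_sum_le_of_le _ fun k hk => ?_
          rw [map_smul, smul_eq_mul, norm_mul]
          exact mul_le_mul_of_nonneg_right (haS k hk) (norm_nonneg _)
      _ = (∑ k ∈ F, ‖g (b.e (σ k))‖) * S := by rw [← Finset.mul_sum, mul_comm]
      _ ≤ max M b.c₂⁻¹ * S :=
          mul_le_mul_of_nonneg_right (hgsum.trans (le_max_left _ _)) hS0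
end
end

section
/- Let B be a Schauder basis with basis constant 𝔎_b of a Banach space X over 𝔽 which is C_sg-w-semi-greedy for a weight w. Let x ∈ X, let G be a greedy set of x, and let F ⊆ ℕ be a finite set with n > j for every n ∈ F and every j ∈ supp(x), and with w(F) ≤ w(G). Then min_{i∈G}|eᵢ*(x)|·‖1_{ηF}‖ ≤ C_sg(1 + 𝔎_b)‖x‖ for every sign η. -/
open scoped BigOperators NNReal

noncomputable section

variable {𝕜 : Type*} [RCLike 𝕜] {X : Type*} [NormedAddCommGroup X] [NormedSpace 𝕜 X]
  [CompleteSpace X]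

open MBasis

/-- For a `C_sg`-`w`-semi-greedy Schauder basis with basis constant `𝔎_b`: if `G` is a
greedy set of `x` and `F` lies beyond the support of `x` with `w(F) ≤ w(G)`, then
`min_{i ∈ G} |eᵢ*(x)| ‖1_{ηF}‖ ≤ C_sg (1 + 𝔎_b) ‖x‖` for every sign `η`. -/
theorem stmt11 (b : MBasis 𝕜 X) (w : ℕ → ℝ) (hw : ∀ n, 0 < w n) (Kb Csg : ℝ)
    (hSch : b.SchauderConst Kb) (h : b.WSemiGreedy w Csg)
    (x : X) (G : Finset ℕ) (hG : b.IsGreedySet x G) (hGne : G.Nonempty)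
    (F : Finset ℕ) (hF : ∀ n ∈ F, ∀ j : ℕ, b.f j x ≠ 0 → j < n)
    (hFG : wSum w F ≤ wSum w G) (η : ℕ → 𝕜) (hη : IsSign η) :
    (G.inf' hGne fun i => ‖b.f i x‖) * ‖b.indic η F‖ ≤ Csg * (1 + Kb) * ‖x‖ := by
  classical
  have he0 : 0 < ‖b.e 0‖ := lt_of_lt_of_le b.c₁_pos (b.c₁_le_e 0)
  have hK : 0 ≤ Kb := by
    have h0 := hSch 0 (b.e 0)
    simp only [Finset.range_zero, Finset.sum_empty, norm_zero] at h0
    by_contra hc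
    push Not at hc
    nlinarith
  have hC : 0 ≤ Csg := by
    obtain ⟨z, hz, hle⟩ := h (b.e 0) ∅ (by intro n hn; simp at hn) ∅ le_rfl (fun _ => 0)
    have h1 : 0 ≤ Csg * ‖b.e 0‖ := by
      refine (norm_nonneg _).trans (hle.trans ?_)
      simp
    by_contra hc
    push Not at hc
    nlinarith
  have hR : 0 ≤ Csg * (1 + Kb) * ‖x‖ := by positivity
  rcases F.eq_empty_or_nonempty with hFe | hFne
  · subst hFe
    simpa [MBasis.indic] using hR
  set a : ℝ := G.inf' hGne fun i => ‖b.f i x‖ with ha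
  have haG : ∀ n ∈ G, a ≤ ‖b.f n x‖ := fun n hn => Finset.inf'_le _ hn
  have ha0 : 0 ≤ a := Finset.le_inf' _ _ (fun i _ => norm_nonneg _)
  rcases ha0.eq_or_lt with ha1 | ha1
  · rw [← ha1, zero_mul]; exact hR
  have hGs : ∀ n ∈ G, b.f n x ≠ 0 := fun n hn => by
    have := haG n hn
    exact norm_pos_iff.1 (ha1.trans_le this)
  have hind : ∀ j, b.f j (b.indic η F) = if j ∈ F then η j else 0 := by
    intro j
    simp [MBasis.indic, map_sum, b.biorth]
  have hFx : ∀ n ∈ F, b.f n x = 0 := fun n hn => by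
    by_contra hc
    exact lt_irrefl _ (hF n hn n hc)
  have hsum : ∑ n ∈ F, ((a : 𝕜) * η n) • b.e n = (a : 𝕜) • b.indic η F := by
    simp [MBasis.indic, Finset.smul_sum, mul_smul]
  have hfy : ∀ j, b.f j (x + (a : 𝕜) • b.indic η F)
      = b.f j x + (if j ∈ F then (a : 𝕜) * η j else 0) := by
    intro j
    rw [map_add, map_smul, hind, smul_eq_mul]
    split_ifs <;> simp
  have hgy : b.IsGreedySet (x + (a : 𝕜) • b.indic η F) G := by
    intro n hn k hk
    have hnF : n ∉ F := fun hc => hGs n hn (hFx n hc)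
    rw [hfy, hfy, if_neg hnF, add_zero]
    by_cases hkF : k ∈ F
    · rw [if_pos hkF, hFx k hkF, zero_add, norm_mul, hη k, mul_one, RCLike.norm_ofReal,
        abs_of_pos ha1]
      exact haG n hn
    · rw [if_neg hkF, add_zero]
      exact hG n hn k hk
  obtain ⟨z, hz, hle⟩ := h _ G hgy F hFG (fun n => (a : 𝕜) * η n)
  rw [hsum, add_sub_cancel_right] at hle
  have hfz : ∀ j, j ∉ G → b.f j z = 0 := by
    intro j hj
    have : z ∈ closure (Submodule.span 𝕜 (b.e '' (G : Set ℕ)) : Set X) := subset_closure hz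
    rw [b.strong] at this
    exact this j (by simpa using hj)
  set u := x + (a : 𝕜) • b.indic η F - z with hu
  set m := F.min' hFne with hm
  have hP : ∀ j, b.f j (∑ i ∈ Finset.range m, b.f i u • b.e i)
      = if j < m then b.f j u else 0 := by
    intro j
    simp [map_sum, b.biorth]
  have key : (a : 𝕜) • b.indic η F = u - ∑ i ∈ Finset.range m, b.f i u • b.e i := by
    rw [← sub_eq_zero]
    apply b.total
    intro j
    rw [map_sub, map_sub, hP, map_smul, hind]
    by_cases hj : j < m
    · have hjF : j ∉ F := fun hc => absurd (F.min'_le j hc) (not_le.2 hj)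
      simp [hj, hjF]
    · have hjx : b.f j x = 0 := by
        by_contra hc
        exact hj (hF m (F.min'_mem hFne) j hc)
      have hjG : j ∉ G := fun hc => hGs j hc hjx
      rw [if_neg hj, hu, map_sub, hfy, hfz j hjG, hjx]
      split_ifs <;> simp
  calc a * ‖b.indic η F‖ = ‖(a : 𝕜) • b.indic η F‖ := by
        rw [norm_smul, RCLike.norm_ofReal, abs_of_pos ha1]
    _ ≤ ‖u‖ + ‖∑ i ∈ Finset.range m, b.f i u • b.e i‖ := by
        rw [key]; exact norm_sub_le _ _
    _ ≤ ‖u‖ + Kb * ‖u‖ := by gcongr; exact hSch m u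
    _ = (1 + Kb) * ‖u‖ := by ring
    _ ≤ (1 + Kb) * (Csg * ‖x‖) := by gcongr
    _ = Csg * (1 + Kb) * ‖x‖ := by ring
end
end

section
/- Let B be a ρ-admissible basis of a Banach space X over 𝔽. Then B is semi-greedy if and only if B is quasi-greedy and disjoint-super-democratic. -/
open scoped BigOperators NNReal

noncomputable section

namespace MBasis

variable {𝕜 : Type*} [RCLike 𝕜] {X : Type*} [NormedAddCommGroup X] [NormedSpace 𝕜 X]

theorem h_fsum (b : MBasis 𝕜 X) (a : ℕ → 𝕜) (A : Finset ℕ) (k : ℕ) :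
    b.f k (∑ n ∈ A, a n • b.e n) = if k ∈ A then a k else 0 := by
  simp [map_sum, b.biorth]

theorem h_findic (b : MBasis 𝕜 X) (a : ℕ → 𝕜) (A : Finset ℕ) (k : ℕ) :
    b.f k (b.indic a A) = if k ∈ A then a k else 0 := b.h_fsum a A k

theorem h_fproj (b : MBasis 𝕜 X) (x : X) (A : Finset ℕ) (k : ℕ) :
    b.f k (b.proj A x) = if k ∈ A then b.f k x else 0 := b.h_fsum _ A k

theorem h_ext (b : MBasis 𝕜 X) {x y : X} (h : ∀ k, b.f k x = b.f k y) : x = y := by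
  rw [← sub_eq_zero]
  exact b.total _ fun j => by rw [map_sub, h j, sub_self]

theorem h_span (b : MBasis 𝕜 X) (A : Set ℕ) {z : X}
    (hz : z ∈ Submodule.span 𝕜 (b.e '' A)) : ∀ k ∉ A, b.f k z = 0 := by
  intro k hk
  induction hz using Submodule.span_induction with
  | mem x hx =>
    obtain ⟨n, hn, rfl⟩ := hx
    rw [b.biorth, if_neg]
    rintro rfl; exact hk hn
  | zero => simp
  | add x y _ _ h1 h2 => simp [h1, h2]
  | smul c x _ h => simp [h]

theorem h_mem_span (b : MBasis 𝕜 X) (A : Finset ℕ) {z : X}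
    (hz : ∀ k ∉ A, b.f k z = 0) : z ∈ Submodule.span 𝕜 (b.e '' (A : Set ℕ)) := by
  have : z = b.proj A z := b.h_ext fun k => by
    rw [h_fproj]; split_ifs with h
    · rfl
    · exact hz k h
  rw [this]
  exact Submodule.sum_mem _ fun n hn => Submodule.smul_mem _ _
    (Submodule.subset_span ⟨n, hn, rfl⟩)

theorem h_span_range (b : MBasis 𝕜 X) {z : X}
    (hz : z ∈ Submodule.span 𝕜 (Set.range b.e)) : ∃ S : Finset ℕ, ∀ k ∉ S, b.f k z = 0 := by
  induction hz using Submodule.span_induction with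
  | mem x hx =>
    obtain ⟨n, rfl⟩ := hx
    refine ⟨{n}, fun k hk => ?_⟩
    rw [b.biorth, if_neg]
    simpa using hk
  | zero => exact ⟨∅, by simp⟩
  | add x y _ _ h1 h2 =>
    obtain ⟨S, hS⟩ := h1
    obtain ⟨T, hT⟩ := h2
    refine ⟨S ∪ T, fun k hk => ?_⟩
    simp only [Finset.mem_union, not_or] at hk
    simp [hS k hk.1, hT k hk.2]
  | smul c x _ h =>
    obtain ⟨S, hS⟩ := h
    exact ⟨S, fun k hk => by simp [hS k hk]⟩

theorem h_c2_pos (b : MBasis 𝕜 X) : 0 < b.c₂ :=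
  lt_of_lt_of_le b.c₁_pos ((b.c₁_le_e 0).trans (b.e_le_c₂ 0))

theorem h_f_le (b : MBasis 𝕜 X) (n : ℕ) (x : X) : ‖b.f n x‖ ≤ b.c₂ * ‖x‖ :=
  (b.f n).le_of_opNorm_le (b.f_le_c₂ n) x

theorem h_approx (b : MBasis 𝕜 X) (x : X) {δ : ℝ} (hδ : 0 < δ) :
    ∃ z, ‖x - z‖ < δ ∧ ∃ S : Finset ℕ, ∀ k ∉ S, b.f k z = 0 := by
  have hx : x ∈ closure (Submodule.span 𝕜 (Set.range b.e) : Set X) := by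
    rw [b.dense_span]; trivial
  obtain ⟨z, hz, hd⟩ := Metric.mem_closure_iff.1 hx δ hδ
  exact ⟨z, by rwa [← dist_eq_norm], b.h_span_range hz⟩

theorem h_fin (b : MBasis 𝕜 X) (x : X) {t : ℝ} (ht : 0 < t) :
    ∃ D : Finset ℕ, ∀ k, k ∈ D ↔ t ≤ ‖b.f k x‖ := by
  have hc := b.h_c2_pos
  obtain ⟨z, hz, S, hS⟩ := b.h_approx x (div_pos ht hc)
  have hsub : {k | t ≤ ‖b.f k x‖} ⊆ (S : Set ℕ) := by
    intro k hk
    by_contra hkS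
    have h1 := b.h_f_le k (x - z)
    rw [map_sub, hS k hkS, sub_zero] at h1
    have h2 : b.c₂ * ‖x - z‖ < b.c₂ * (t / b.c₂) := by gcongr
    rw [mul_div_cancel₀ _ hc.ne'] at h2
    have : t ≤ ‖b.f k x‖ := hk
    linarith
  exact ⟨(S.finite_toSet.subset hsub).toFinset, by simp⟩

theorem h_far (N m : ℕ) : ∃ F : Finset ℕ, F.card = m ∧ ∀ n ∈ F, N ≤ n := by
  refine ⟨Finset.Ico N (N + m), by simp, fun n hn => (Finset.mem_Ico.1 hn).1⟩

theorem h_disj (S F : Finset ℕ) (h : ∀ n ∈ F, S.sup id + 1 ≤ n) : ∀ k ∈ F, k ∉ S := by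
  intro k hk hS
  have h1 := h k hk
  have h2 : id k ≤ S.sup id := Finset.le_sup hS
  simp only [id] at h2
  omega

theorem h_adm (b : MBasis 𝕜 X) {ρ : ℝ} (hadm : b.RhoAdmissible ρ) (S : Finset ℕ) :
    ∃ N, ∀ F : Finset ℕ, (∀ n ∈ F, N ≤ n) → F.card ≤ S.card → (∀ k ∈ F, k ∉ S) ∧
      ∀ u v : X, (∀ k ∉ S, b.f k u = 0) → (∀ k ∉ F, b.f k v = 0) →
        ‖u‖ ≤ ρ * ‖u + v‖ := by
  obtain ⟨n₀, h⟩ := hadm S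
  refine ⟨max n₀ (S.sup id + 1), fun F hF hc => ?_⟩
  have hd := h_disj S F fun n hn => (le_max_right _ _).trans (hF n hn)
  refine ⟨hd, fun u v hu hv => ?_⟩
  have := h F (fun n hn => (le_max_left _ _).trans (hF n hn)) hc (fun n => b.f n (u + v))
  convert this using 2
  · apply b.h_ext
    intro k
    rw [h_fsum]
    split_ifs with hk
    · rw [map_add, hv k (fun hkF => hd k hkF hk), add_zero]
    · exact hu k hk
  · congr 1
    apply b.h_ext
    intro k
    rw [h_fsum]
    split_ifs with hk
    · rfl
    · simp only [Finset.mem_union, not_or] at hk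
      rw [map_add, hu k hk.1, hv k hk.2, add_zero]

theorem h_adm2 {ρ : ℝ} {u v : X} (h : ‖u‖ ≤ ρ * ‖u + v‖) : ‖v‖ ≤ (1 + ρ) * ‖u + v‖ := by
  have : ‖v‖ ≤ ‖u + v‖ + ‖u‖ := by
    have := norm_sub_le (u + v) u
    simpa using this
  linarith

theorem h_semi_dsd (b : MBasis 𝕜 X) {ρ : ℝ} (hρ : 1 ≤ ρ) (hadm : b.RhoAdmissible ρ)
    {C : ℝ} (hC : 0 ≤ C) (h : b.SemiGreedy C) :
    b.DisjSuperDemocratic (ρ * C * ((1 + ρ) * C)) := by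
  intro A B hAB hcard ε ε' hε hε'
  obtain ⟨N₁, h₁⟩ := b.h_adm hadm A
  obtain ⟨N₂, h₂⟩ := b.h_adm hadm B
  obtain ⟨F, hFc, hF⟩ := h_far (max N₁ N₂) A.card
  obtain ⟨d₁, h₁⟩ := h₁ F (fun n hn => (le_max_left _ _).trans (hF n hn)) hFc.le
  obtain ⟨d₂, h₂⟩ := h₂ F (fun n hn => (le_max_right _ _).trans (hF n hn)) (hFc.le.trans hcard)
  set w : X := b.indic (fun _ => (1 : 𝕜)) F with hw
  have hfw : ∀ k, b.f k w = if k ∈ F then 1 else 0 := fun k => b.h_findic _ F k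
  have s1 : ‖b.indic ε A‖ ≤ ρ * C * ‖w‖ := by
    obtain ⟨z, hz, hn⟩ := h (b.indic ε A + w) F (by
      intro n hn k hk
      rw [map_add, map_add, h_findic b _ _ k, h_findic b _ _ n, hfw k, hfw n, if_neg hk, if_pos hn, if_neg (d₁ n hn)]
      split_ifs <;> simp [hε k]) A hFc.ge ε
    have hz' := b.h_span _ hz
    have e1 : b.indic ε A + w - ∑ n ∈ A, ε n • b.e n = w := by
      simp [indic]
    rw [e1] at hn
    have := h₁ (b.indic ε A) (w - z) (fun k hk => by rw [h_findic, if_neg hk])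
      (fun k hk => by rw [map_sub, hfw, if_neg hk, hz' k (by simpa using hk), sub_zero])
    rw [← add_sub_assoc] at this
    calc _ ≤ _ := this
      _ ≤ ρ * (C * ‖w‖) := by gcongr
      _ = _ := by ring
  have s2 : ‖w‖ ≤ (1 + ρ) * C * ‖b.indic ε' B‖ := by
    obtain ⟨z, hz, hn⟩ := h (b.indic ε' B + w) B (by
      intro n hn k hk
      have hnF : n ∉ F := fun hh => d₂ n hh hn
      rw [map_add, map_add, h_findic b _ _ k, h_findic b _ _ n, hfw k, hfw n, if_neg hk, if_pos hn, if_neg hnF]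
      split_ifs <;> simp [hε' n]) F (hFc.le.trans hcard) (fun _ => 1)
    have hz' := b.h_span _ hz
    have e1 : b.indic ε' B + w - ∑ n ∈ F, (1 : 𝕜) • b.e n = b.indic ε' B := by
      simp [hw, indic]
    rw [e1] at hn
    have := h_adm2 (h₂ (b.indic ε' B - z) w
      (fun k hk => by rw [map_sub, h_findic, if_neg hk, hz' k (by simpa using hk), sub_zero])
      (fun k hk => by rw [hfw, if_neg hk]))
    rw [show b.indic ε' B - z + w = b.indic ε' B + w - z by abel] at this
    calc _ ≤ _ := this
      _ ≤ (1 + ρ) * (C * ‖b.indic ε' B‖) := by gcongr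
      _ = _ := by ring
  calc _ ≤ _ := s1
    _ ≤ ρ * C * ((1 + ρ) * C * ‖b.indic ε' B‖) := by gcongr
    _ = _ := by ring

theorem h_thr (b : MBasis 𝕜 X) (x : X) (Λ : Finset ℕ) (h : b.IsGreedySet x Λ) :
    ∃ t : ℝ, 0 ≤ t ∧ (∀ n ∈ Λ, t ≤ ‖b.f n x‖) ∧ (∀ k ∉ Λ, ‖b.f k x‖ ≤ t) := by
  rcases Λ.eq_empty_or_nonempty with rfl | hne
  · exact ⟨b.c₂ * ‖x‖, mul_nonneg b.h_c2_pos.le (norm_nonneg _), by simp,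
      fun k _ => b.h_f_le k x⟩
  · obtain ⟨m, hm, hmin⟩ := Λ.exists_min_image (fun n => ‖b.f n x‖) hne
    exact ⟨‖b.f m x‖, norm_nonneg _, hmin, fun k hk => h m hm k hk⟩

theorem h_semi_qg_fin (b : MBasis 𝕜 X) {ρ : ℝ} (hρ : 1 ≤ ρ) (hadm : b.RhoAdmissible ρ)
    {C : ℝ} (hC : 0 ≤ C) (h : b.SemiGreedy C) (x : X) (Λ : Finset ℕ)
    (hg : b.IsGreedySet x Λ) (S : Finset ℕ) (hS : ∀ k ∉ S, b.f k x = 0) :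
    ‖x - b.proj Λ x‖ ≤ ρ * C * (1 + (1 + ρ) * C) * ‖x‖ := by
  obtain ⟨t, ht, htΛ, htc⟩ := b.h_thr x Λ hg
  obtain ⟨N, hN⟩ := b.h_adm hadm (S ∪ Λ)
  obtain ⟨F, hFc, hF⟩ := h_far N Λ.card
  obtain ⟨d, had⟩ := hN F hF (hFc.le.trans (Finset.card_le_card Finset.subset_union_right))
  have dS : ∀ k ∈ F, k ∉ S := fun k hk hs => d k hk (Finset.mem_union_left _ hs)
  have dΛ : ∀ k ∈ F, k ∉ Λ := fun k hk hs => d k hk (Finset.mem_union_right _ hs)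
  set w : X := ∑ n ∈ F, (t : 𝕜) • b.e n with hw
  have hfw : ∀ k, b.f k w = if k ∈ F then (t : 𝕜) else 0 := fun k => b.h_fsum _ F k
  have hnt : ‖(t : 𝕜)‖ = t := by rw [RCLike.norm_ofReal, abs_of_nonneg ht]
  have s1 : ‖w‖ ≤ (1 + ρ) * C * ‖x‖ := by
    obtain ⟨z, hz, hn⟩ := h (x + w) Λ (by
      intro n hn k hk
      have hnF : n ∉ F := fun hh => dΛ n hh hn
      rw [map_add, map_add, hfw, hfw, if_neg hnF, add_zero]
      split_ifs with hkF
      · rw [hS k (dS k hkF), zero_add, hnt]; exact htΛ n hn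
      · rw [add_zero]; exact hg n hn k hk) F hFc.le (fun _ => (t : 𝕜))
    have hz' := b.h_span _ hz
    rw [← hw, add_sub_cancel_right] at hn
    have := h_adm2 (had (x - z) w (fun k hk => by
      simp only [Finset.mem_union, not_or] at hk
      rw [map_sub, hS k hk.1, hz' k (by simpa using hk.2), sub_zero])
      (fun k hk => by rw [hfw, if_neg hk]))
    rw [show x - z + w = x + w - z by abel] at this
    calc _ ≤ _ := this
      _ ≤ (1 + ρ) * (C * ‖x‖) := by gcongr
      _ = _ := by ring
  obtain ⟨z, hz, hn⟩ := h (x - b.proj Λ x + w) F (by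
    intro n hn k hk
    rw [map_add, map_add, hfw, hfw, if_pos hn, if_neg hk, add_zero, map_sub, map_sub, h_fproj,
      h_fproj, if_neg (dΛ n hn), hS n (dS n hn), sub_zero, zero_add, hnt]
    split_ifs with hkΛ
    · simpa using ht
    · rw [sub_zero]; exact htc k hkΛ) Λ hFc.ge (fun n => - b.f n x)
  have hz' := b.h_span _ hz
  have e1 : x - b.proj Λ x + w - ∑ n ∈ Λ, (- b.f n x) • b.e n = x + w := by
    simp only [proj, neg_smul, Finset.sum_neg_distrib]; abel
  rw [e1] at hn
  have := had (x - b.proj Λ x) (w - z) (fun k hk => by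
      simp only [Finset.mem_union, not_or] at hk
      rw [map_sub, hS k hk.1, h_fproj, if_neg hk.2, sub_zero])
      (fun k hk => by rw [map_sub, hfw, if_neg hk, hz' k (by simpa using hk), sub_zero])
  rw [← add_sub_assoc] at this
  calc _ ≤ _ := this
    _ ≤ ρ * (C * (‖x‖ + (1 + ρ) * C * ‖x‖)) := by
      gcongr
      refine hn.trans ?_
      gcongr
      exact (norm_add_le _ _).trans (by gcongr)
    _ = _ := by ring

theorem h_sgn (a : 𝕜) : ∃ s : 𝕜, ‖s‖ = 1 ∧ a = (‖a‖ : 𝕜) * s := by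
  by_cases ha : a = 0
  · exact ⟨1, by simp, by simp [ha]⟩
  · have : (‖a‖ : 𝕜) ≠ 0 := by simpa using ha
    refine ⟨a / (‖a‖ : 𝕜), ?_, by field_simp⟩
    rw [norm_div, RCLike.norm_ofReal, abs_norm, div_self (norm_ne_zero_iff.2 ha)]

theorem h_semi_qg (b : MBasis 𝕜 X) {ρ : ℝ} (hρ : 1 ≤ ρ) (hadm : b.RhoAdmissible ρ)
    {C : ℝ} (hC : 0 ≤ C) (h : b.SemiGreedy C) :
    b.QuasiGreedy (ρ * C * (1 + (1 + ρ) * C)) := by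
  intro x Λ hg
  set K := ρ * C * (1 + (1 + ρ) * C)
  have hcl : IsClosed {y : X | ‖y - b.proj Λ y‖ ≤ K * ‖y‖} := by
    apply isClosed_le
    · unfold proj; fun_prop
    · fun_prop
  refine hcl.closure_subset (Metric.mem_closure_iff.2 fun η hη => ?_)
  have hc := b.h_c2_pos
  set M : ℝ := 1 + Λ.card * (2 * b.c₂ * b.c₂) with hM
  have hMpos : 0 < M := by positivity
  obtain ⟨δ, hδ, hδM⟩ : ∃ δ : ℝ, 0 < δ ∧ δ * M = η := ⟨η / M, by positivity, by field_simp⟩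
  obtain ⟨z, hz, S, hS⟩ := b.h_approx x hδ
  choose s hs1 hs2 using fun n => h_sgn (b.f n x)
  have hxz : ∀ k, ‖b.f k x - b.f k z‖ ≤ b.c₂ * δ := fun k => by
    rw [← map_sub]
    exact (b.h_f_le k _).trans (by gcongr)
  set a : ℕ → 𝕜 := fun n => b.f n x + ((b.c₂ * δ : ℝ) : 𝕜) * s n - b.f n z with ha
  have hcd : ‖((b.c₂ * δ : ℝ) : 𝕜)‖ = b.c₂ * δ := by
    rw [RCLike.norm_ofReal, abs_of_pos (by positivity)]
  have hna : ∀ n, ‖a n‖ ≤ 2 * b.c₂ * δ := fun n => by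
    have : a n = (b.f n x - b.f n z) + ((b.c₂ * δ : ℝ) : 𝕜) * s n := by simp only [ha]; ring
    rw [this]
    refine (norm_add_le _ _).trans ?_
    rw [norm_mul, hs1, hcd]
    linarith [hxz n]
  set y : X := z + ∑ n ∈ Λ, a n • b.e n with hy
  have hyin : ∀ n ∈ Λ, ‖b.f n y‖ = ‖b.f n x‖ + b.c₂ * δ := fun n hn => by
    rw [hy, map_add, h_fsum, if_pos hn]
    have : b.f n z + a n = ((‖b.f n x‖ + b.c₂ * δ : ℝ) : 𝕜) * s n := by
      simp only [ha]
      push_cast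
      linear_combination hs2 n
    rw [this, norm_mul, hs1, mul_one, RCLike.norm_ofReal, abs_of_nonneg (by positivity)]
  refine ⟨y, ?_, ?_⟩
  · refine b.h_semi_qg_fin hρ hadm hC h y Λ ?_ (S ∪ Λ) ?_
    · intro n hn k hk
      rw [hyin n hn, hy, map_add, h_fsum, if_neg hk, add_zero]
      have h1 := hg n hn k hk
      have h2 := hxz k
      have h3 := norm_sub_norm_le (b.f k z) (b.f k x)
      rw [norm_sub_rev] at h3
      linarith
    · intro k hk
      simp only [Finset.mem_union, not_or] at hk
      rw [hy, map_add, h_fsum, if_neg hk.2, hS k hk.1, add_zero]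
  · rw [dist_eq_norm]
    have h1 : ‖∑ n ∈ Λ, a n • b.e n‖ ≤ Λ.card * (2 * b.c₂ * δ * b.c₂) := by
      refine (norm_sum_le _ _).trans ?_
      rw [← nsmul_eq_mul]
      refine Finset.sum_le_card_nsmul _ _ _ fun n _ => ?_
      rw [norm_smul]
      exact mul_le_mul (hna n) (b.e_le_c₂ n) (norm_nonneg _) (by positivity)
    have h2 : ‖x - y‖ ≤ ‖x - z‖ + ‖∑ n ∈ Λ, a n • b.e n‖ := by
      rw [hy, ← sub_sub]; exact norm_sub_le _ _
    have h3 : δ * M = δ + Λ.card * (2 * b.c₂ * δ * b.c₂) := by rw [hM]; ring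
    linarith

theorem h_conv (b : MBasis 𝕜 X) (M : ℝ) (E : Finset ℕ) : ∀ x₀ : X,
    (∀ ε : ℕ → 𝕜, IsSign ε → ‖x₀ + b.indic ε E‖ ≤ M) →
    ∀ a : ℕ → 𝕜, (∀ n ∈ E, ‖a n‖ ≤ 1) → ‖x₀ + ∑ n ∈ E, a n • b.e n‖ ≤ M := by
  induction E using Finset.induction_on with
  | empty =>
    intro x₀ h a _
    simpa [indic] using h (fun _ => 1) (fun _ => by simp)
  | insert m E hm ih =>
    intro x₀ h a ha
    rw [Finset.sum_insert hm, ← add_assoc]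
    refine ih _ ?_ a (fun n hn => ha n (Finset.mem_insert_of_mem hn))
    intro ε hε
    obtain ⟨s, hs, has⟩ := h_sgn (a m)
    have hr : ‖a m‖ ≤ 1 := ha m (Finset.mem_insert_self _ _)
    have hr0 := norm_nonneg (a m)
    set r := ‖a m‖
    have key : ∀ s' : 𝕜, ‖s'‖ = 1 → ‖x₀ + s' • b.e m + b.indic ε E‖ ≤ M := by
      intro s' hs'
      have := h (Function.update ε m s') (fun n => by
        by_cases hn : n = m
        · subst hn; simpa using hs'
        · simpa [hn] using hε n)
      rw [indic, Finset.sum_insert hm, Function.update_self, ← add_assoc] at this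
      convert this using 3
      refine Finset.sum_congr rfl fun n hn => ?_
      rw [Function.update_of_ne]
      rintro rfl; exact hm hn
    have e : x₀ + a m • b.e m + b.indic ε E
        = (((1 + r) / 2 : ℝ) : 𝕜) • (x₀ + s • b.e m + b.indic ε E)
          + (((1 - r) / 2 : ℝ) : 𝕜) • (x₀ + (-s) • b.e m + b.indic ε E) := by
      rw [has]
      push_cast
      module
    rw [e]
    refine (norm_add_le _ _).trans ?_
    rw [norm_smul, norm_smul, RCLike.norm_ofReal, RCLike.norm_ofReal,
      abs_of_nonneg (by linarith), abs_of_nonneg (by linarith)]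
    have k1 := key s hs
    have k2 := key (-s) (by simpa using hs)
    nlinarith

theorem h_trunc (b : MBasis 𝕜 X) {C : ℝ} (h : b.QuasiGreedy C) (y : X) {t : ℝ} (ht : 0 < t)
    (m : ℕ) : ∀ D : Finset ℕ, D.card = m → b.IsGreedySet y D → (∀ n ∈ D, t ≤ ‖b.f n y‖) →
    ∀ μ : ℝ, 0 ≤ μ → (∀ n ∈ D, t / ‖b.f n y‖ ≤ μ) →
      ‖(μ : 𝕜) • (y - b.proj D y) + ∑ n ∈ D, (((t / ‖b.f n y‖ : ℝ) : 𝕜) * b.f n y) • b.e n‖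
        ≤ μ * (C * ‖y‖) := by
  induction m with
  | zero =>
    intro D hD hg _ μ hμ _
    have := h y D hg
    rw [Finset.card_eq_zero] at hD
    subst hD
    rw [Finset.sum_empty, add_zero, norm_smul, RCLike.norm_ofReal, abs_of_nonneg hμ]
    gcongr
  | succ m ih =>
    intro D hD hg hDt μ hμ hμD
    obtain ⟨n₀, hn₀, hmin⟩ := D.exists_min_image (fun n => ‖b.f n y‖)
      (Finset.card_pos.1 (by omega))
    set l := t / ‖b.f n₀ y‖ with hl
    have hpos : 0 < ‖b.f n₀ y‖ := ht.trans_le (hDt n₀ hn₀)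
    have hl0 : 0 ≤ l := by positivity
    have hlμ : l ≤ μ := hμD n₀ hn₀
    have := ih (D.erase n₀) (by rw [Finset.card_erase_of_mem hn₀, hD]; rfl) (by
      intro n hn k hk
      have hnD := Finset.mem_of_mem_erase hn
      by_cases hkD : k ∈ D
      · have : k = n₀ := by
          by_contra hne; exact hk (Finset.mem_erase.2 ⟨hne, hkD⟩)
        subst this; exact hmin n hnD
      · exact hg n hnD k hkD) (fun n hn => hDt n (Finset.mem_of_mem_erase hn)) l hl0
      (fun n hn => by
        have := hmin n (Finset.mem_of_mem_erase hn)
        rw [hl]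
        gcongr)
    have h2 := h y D hg
    have p : b.proj D y = b.f n₀ y • b.e n₀ + b.proj (D.erase n₀) y :=
      (Finset.add_sum_erase D (fun n => b.f n y • b.e n) hn₀).symm
    have e : (μ : 𝕜) • (y - b.proj D y)
          + ∑ n ∈ D, (((t / ‖b.f n y‖ : ℝ) : 𝕜) * b.f n y) • b.e n
        = ((μ - l : ℝ) : 𝕜) • (y - b.proj D y)
          + ((l : 𝕜) • (y - b.proj (D.erase n₀) y)
          + ∑ n ∈ D.erase n₀, (((t / ‖b.f n y‖ : ℝ) : 𝕜) * b.f n y) • b.e n) := by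
      rw [← Finset.add_sum_erase D _ hn₀, p, ← hl]
      push_cast
      module
    rw [e]
    refine (norm_add_le _ _).trans ?_
    rw [norm_smul, RCLike.norm_ofReal, abs_of_nonneg (by linarith)]
    have : (μ - l) * ‖y - b.proj D y‖ ≤ (μ - l) * (C * ‖y‖) := by
      have : 0 ≤ μ - l := by linarith
      gcongr
    nlinarith

theorem h_dsd_sd (b : MBasis 𝕜 X) {C : ℝ} (hC : 0 ≤ C) (h : b.DisjSuperDemocratic C) :
    b.SuperDemocratic (C * C) := by
  intro A B hAB ε ε' hε hε'
  obtain ⟨F, hFc, hF⟩ := h_far ((A ∪ B).sup id + 1) A.card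
  have d := h_disj _ _ hF
  have d1 : Disjoint A F := Finset.disjoint_right.2 fun k hk hh =>
    d k hk (Finset.mem_union_left _ hh)
  have d2 : Disjoint F B := Finset.disjoint_left.2 fun k hk hh =>
    d k hk (Finset.mem_union_right _ hh)
  have h1 := h A F d1 hFc.ge ε ε hε hε
  have h2 := h F B d2 (hFc.le.trans hAB) ε ε' hε hε'
  calc _ ≤ _ := h1
    _ ≤ C * (C * ‖b.indic ε' B‖) := by gcongr
    _ = _ := by ring

theorem h_back (b : MBasis 𝕜 X) {C K : ℝ} (hC : 0 ≤ C) (hK : 0 ≤ K) (hq : b.QuasiGreedy C)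
    (hs : b.SuperDemocratic K) : b.SemiGreedy (C + 2 * K * (2 * C)) := by
  intro x Λ hg A hA a
  obtain ⟨t, ht, htΛ, htc⟩ := b.h_thr x Λ hg
  rcases ht.eq_or_lt with rfl | ht
  · refine ⟨x, b.h_mem_span Λ fun k hk => norm_le_zero_iff.1 (htc k hk), ?_⟩
    rw [sub_self, norm_zero]; positivity
  set y : X := x - ∑ n ∈ A, a n • b.e n with hy
  have hfy : ∀ k ∉ A, b.f k y = b.f k x := fun k hk => by
    rw [hy, map_sub, h_fsum, if_neg hk, sub_zero]
  obtain ⟨D, hD⟩ := b.h_fin y ht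
  have hDg : b.IsGreedySet y D := fun n hn k hk => by
    rw [hD] at hn hk
    linarith
  set T : X := (y - b.proj D y) + ∑ n ∈ D, (((t / ‖b.f n y‖ : ℝ) : 𝕜) * b.f n y) • b.e n with hT
  have hTn : ‖T‖ ≤ C * ‖y‖ := by
    have := b.h_trunc hq y ht D.card D rfl hDg (fun n hn => (hD n).1 hn) 1 zero_le_one
      (fun n hn => div_le_one_of_le₀ ((hD n).1 hn) (norm_nonneg _))
    rw [RCLike.ofReal_one, one_smul, one_mul] at this
    exact this
  have hfT : ∀ k, b.f k T = if k ∈ D then ((t / ‖b.f k y‖ : ℝ) : 𝕜) * b.f k y else b.f k y := by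
    intro k
    rw [hT, map_add, map_sub, h_fproj, h_fsum]
    split_ifs <;> simp
  have hfTle : ∀ k, ‖b.f k T‖ ≤ t := by
    intro k
    rw [hfT]
    split_ifs with hk
    · rw [hD] at hk
      have : 0 < ‖b.f k y‖ := ht.trans_le hk
      rw [norm_mul, RCLike.norm_ofReal, abs_of_nonneg (by positivity)]
      exact (div_mul_cancel₀ _ this.ne').le
    · rw [hD] at hk; linarith
  choose s hs1 hs2 using fun n => h_sgn (b.f n y)
  have hsD : t * ‖b.indic s D‖ ≤ 2 * C * ‖y‖ := by
    have e : T - (y - b.proj D y) = (t : 𝕜) • b.indic s D := by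
      rw [hT, add_sub_cancel_left, indic, Finset.smul_sum]
      refine Finset.sum_congr rfl fun n hn => ?_
      rw [hD] at hn
      have hp : 0 < ‖b.f n y‖ := ht.trans_le hn
      have hp' : (‖b.f n y‖ : 𝕜) ≠ 0 := by
        exact_mod_cast hp.ne'
      rw [smul_smul]
      congr 1
      nth_rewrite 2 [hs2 n]
      push_cast
      field_simp
    have h1 := norm_sub_le T (y - b.proj D y)
    rw [e, norm_smul, RCLike.norm_ofReal, abs_of_pos ht] at h1
    have h2 := hq y D hDg
    linarith
  set E := A \ Λ with hE
  have hcard : E.card ≤ D.card := by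
    have h1 : (A \ Λ).card ≤ (Λ \ A).card := Finset.card_sdiff_le_card_sdiff_iff.2 hA
    refine h1.trans (Finset.card_le_card fun n hn => ?_)
    rw [Finset.mem_sdiff] at hn
    rw [hD, hfy n hn.2]
    exact htΛ n hn.1
  set c : ℕ → 𝕜 := fun n => ((2 * t : ℝ) : 𝕜)⁻¹ * (b.f n x - b.f n T) with hc
  have h2t : ‖((2 * t : ℝ) : 𝕜)‖ = 2 * t := by
    rw [RCLike.norm_ofReal, abs_of_pos (by positivity)]
  have h2t' : ((2 * t : ℝ) : 𝕜) ≠ 0 := by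
    rw [← norm_ne_zero_iff, h2t]; positivity
  have hcn : ∀ n ∈ E, ‖c n‖ ≤ 1 := by
    intro n hn
    rw [hE, Finset.mem_sdiff] at hn
    rw [hc, norm_mul, norm_inv, h2t]
    rw [inv_mul_le_iff₀ (by positivity)]
    refine (norm_sub_le _ _).trans ?_
    linarith [htc n hn.2, hfTle n]
  have hcE : ‖∑ n ∈ E, c n • b.e n‖ ≤ K * ‖b.indic s D‖ := by
    have := b.h_conv (K * ‖b.indic s D‖) E 0 (fun ε hε => by
      rw [zero_add]; exact hs E D hcard ε s hε hs1) c hcn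
    simpa using this
  set H : X := T + ((2 * t : ℝ) : 𝕜) • ∑ n ∈ E, c n • b.e n with hH
  have hfH : ∀ k ∉ Λ, b.f k H = b.f k x := by
    intro k hk
    rw [hH, map_add, map_smul, h_fsum, smul_eq_mul]
    split_ifs with hkE
    · simp only [hc]
      rw [mul_inv_cancel_left₀ h2t']; ring
    · have hkA : k ∉ A := fun hh => hkE (Finset.mem_sdiff.2 ⟨hh, hk⟩)
      rw [mul_zero, add_zero, hfT]
      split_ifs with hkD
      · rw [hD] at hkD
        have h1 := htc k hk
        rw [← hfy k hkA] at h1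
        have h3 : ‖b.f k y‖ = t := le_antisymm h1 hkD
        rw [h3, div_self ht.ne', hfy k hkA]; simp
      · exact hfy k hkA
  refine ⟨x - H, b.h_mem_span Λ fun k hk => by rw [map_sub, hfH k hk, sub_self], ?_⟩
  rw [sub_sub_cancel]
  calc ‖H‖ ≤ ‖T‖ + 2 * t * ‖∑ n ∈ E, c n • b.e n‖ := by
        rw [hH]; refine (norm_add_le _ _).trans ?_
        rw [norm_smul, h2t]
    _ ≤ C * ‖y‖ + 2 * t * (K * ‖b.indic s D‖) := by gcongr
    _ = C * ‖y‖ + 2 * K * (t * ‖b.indic s D‖) := by ring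
    _ ≤ C * ‖y‖ + 2 * K * (2 * C * ‖y‖) := by gcongr
    _ = _ := by ring

end MBasis

variable {𝕜 : Type*} [RCLike 𝕜] {X : Type*} [NormedAddCommGroup X] [NormedSpace 𝕜 X]
  [CompleteSpace X]

open MBasis

/-- A `ρ`-admissible basis is semi-greedy iff it is quasi-greedy and
disjoint-super-democratic. -/
theorem stmt13 (b : MBasis 𝕜 X) (ρ : ℝ) (hρ : 1 ≤ ρ) (hadm : b.RhoAdmissible ρ) :
    (∃ C : ℝ, b.SemiGreedy C) ↔
      ((∃ C : ℝ, b.QuasiGreedy C) ∧ (∃ C : ℝ, b.DisjSuperDemocratic C)) := by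
  constructor
  · rintro ⟨C, h⟩
    have h' : b.SemiGreedy |C| := fun x Λ hg A hA a => by
      obtain ⟨z, hz, hn⟩ := h x Λ hg A hA a
      exact ⟨z, hz, hn.trans (mul_le_mul_of_nonneg_right (le_abs_self C) (norm_nonneg _))⟩
    exact ⟨⟨_, b.h_semi_qg hρ hadm (abs_nonneg C) h'⟩,
      ⟨_, b.h_semi_dsd hρ hadm (abs_nonneg C) h'⟩⟩
  · rintro ⟨⟨C, hq⟩, ⟨K, hd⟩⟩
    have hq' : b.QuasiGreedy |C| := fun x Λ hg =>
      (hq x Λ hg).trans (mul_le_mul_of_nonneg_right (le_abs_self C) (norm_nonneg _))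
    have hd' : b.DisjSuperDemocratic |K| := fun A B h1 h2 ε ε' h3 h4 =>
      (hd A B h1 h2 ε ε' h3 h4).trans
        (mul_le_mul_of_nonneg_right (le_abs_self K) (norm_nonneg _))
    exact ⟨_, b.h_back (abs_nonneg C) (by positivity) hq' (b.h_dsd_sd (abs_nonneg K) hd')⟩
end
end

section
/- Let B be a ρ-admissible basis of a Banach space X over 𝔽. If B is C_sg-semi-greedy, then B is C_sd-disjoint-super-democratic with C_sd ≤ C_sg²·ρ·(1 + ρ) and C_q-quasi-greedy with C_q ≤ C_sg·ρ·(1 + (1 + ρ)C_sg). -/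
open scoped BigOperators NNReal

noncomputable section

variable {𝕜 : Type*} [RCLike 𝕜] {X : Type*} [NormedAddCommGroup X] [NormedSpace 𝕜 X]
  [CompleteSpace X]

open MBasis

namespace MBasis

lemma coef_zero' (b : MBasis 𝕜 X) {A : Set ℕ} {x : X}
    (hx : x ∈ Submodule.span 𝕜 (b.e '' A)) {j : ℕ} (hj : j ∉ A) : b.f j x = 0 := by
  have h1 : x ∈ closure (Submodule.span 𝕜 (b.e '' A) : Set X) := subset_closure hx
  rw [b.strong] at h1
  exact h1 j hj

lemma coef_sum' (b : MBasis 𝕜 X) (A : Finset ℕ) (a : ℕ → 𝕜) (j : ℕ) :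
    b.f j (∑ n ∈ A, a n • b.e n) = if j ∈ A then a j else 0 := by
  simp [map_sum, b.biorth]

lemma sum_mem' (b : MBasis 𝕜 X) (A : Finset ℕ) (a : ℕ → 𝕜) {S : Set ℕ} (hS : (A : Set ℕ) ⊆ S) :
    ∑ n ∈ A, a n • b.e n ∈ Submodule.span 𝕜 (b.e '' S) :=
  Submodule.sum_mem _ fun n hn => Submodule.smul_mem _ _
    (Submodule.subset_span ⟨n, hS hn, rfl⟩)

lemma eq_sum' (b : MBasis 𝕜 X) {A : Finset ℕ} {x : X}
    (hx : x ∈ Submodule.span 𝕜 (b.e '' (A : Set ℕ))) : x = ∑ n ∈ A, b.f n x • b.e n := by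
  refine sub_eq_zero.1 (b.total _ fun j => ?_)
  rw [map_sub, coef_sum']
  split_ifs with hj
  · simp
  · rw [b.coef_zero' hx (by simpa using hj)]; simp

lemma exists_good' (b : MBasis 𝕜 X) {ρ : ℝ} (hadm : b.RhoAdmissible ρ) (E : Finset ℕ) (m : ℕ)
    (hm : m ≤ E.card) : ∃ D : Finset ℕ, D.card = m ∧ Disjoint E D ∧
      ∀ x ∈ Submodule.span 𝕜 (b.e '' (E : Set ℕ)), ∀ z ∈ Submodule.span 𝕜 (b.e '' (D : Set ℕ)),
        ‖x‖ ≤ ρ * ‖x + z‖ := by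
  obtain ⟨n₀, h₀⟩ := hadm E
  set N := max n₀ (E.sup id + 1) with hN
  have hdis : Disjoint E (Finset.Ico N (N + m)) := by
    rw [Finset.disjoint_left]
    intro a ha ha'
    have h1 : a ≤ E.sup id := Finset.le_sup (f := id) ha
    have h2 := (Finset.mem_Ico.1 ha').1
    omega
  refine ⟨Finset.Ico N (N + m), by simp, hdis, ?_⟩
  intro x hx z hz
  have h3 := h₀ (Finset.Ico N (N + m)) (fun n hn => by
    have h2 := (Finset.mem_Ico.1 hn).1
    omega) (by simpa using hm) (fun n => b.f n (x + z))
  rw [Finset.sum_union hdis] at h3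
  have e1 : ∑ n ∈ E, b.f n (x + z) • b.e n = x := by
    conv_rhs => rw [b.eq_sum' hx]
    refine Finset.sum_congr rfl fun n hn => ?_
    rw [map_add, b.coef_zero' hz (by
      have := Finset.disjoint_left.1 hdis hn
      exact_mod_cast this), add_zero]
  have e2 : ∑ n ∈ Finset.Ico N (N + m), b.f n (x + z) • b.e n = z := by
    conv_rhs => rw [b.eq_sum' hz]
    refine Finset.sum_congr rfl fun n hn => ?_
    rw [map_add, b.coef_zero' hx (by
      have := Finset.disjoint_right.1 hdis hn
      exact_mod_cast this), zero_add]
  rwa [e1, e2] at h3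

lemma one_le_C' (b : MBasis 𝕜 X) {C : ℝ} (h : b.SemiGreedy C) : 1 ≤ C := by
  obtain ⟨z, hz, h1⟩ := h (b.e 0) ∅ (by intro n hn; simp at hn) ∅ le_rfl 0
  have hz0 : z = 0 := by simpa using hz
  have hp : 0 < ‖b.e 0‖ := b.c₁_pos.trans_le (b.c₁_le_e 0)
  simp only [hz0, sub_zero, Finset.sum_empty] at h1
  by_contra hc
  nlinarith

lemma L1' (b : MBasis 𝕜 X) {ρ C : ℝ} (hρ : 1 ≤ ρ) (h : b.SemiGreedy C) {E D Λ : Finset ℕ}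
    (hED : Disjoint E D) (hΛ : Λ ⊆ E) (hcard : D.card ≤ Λ.card)
    (hg : ∀ x ∈ Submodule.span 𝕜 (b.e '' (E : Set ℕ)),
      ∀ z ∈ Submodule.span 𝕜 (b.e '' (D : Set ℕ)), ‖x‖ ≤ ρ * ‖x + z‖)
    {t : ℝ} (ht : 0 ≤ t) {x : X} (hx : x ∈ Submodule.span 𝕜 (b.e '' (E : Set ℕ)))
    (h1 : ∀ n ∈ Λ, t ≤ ‖b.f n x‖) (h2 : ∀ k ∉ Λ, ‖b.f k x‖ ≤ t) :
    ‖∑ n ∈ D, (t : 𝕜) • b.e n‖ ≤ (1 + ρ) * C * ‖x‖ := by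
  set d := ∑ n ∈ D, (t : 𝕜) • b.e n with hd
  have hdD : d ∈ Submodule.span 𝕜 (b.e '' (D : Set ℕ)) := b.sum_mem' D (fun _ => (t : 𝕜)) subset_rfl
  have hfd : ∀ j, b.f j d = if j ∈ D then (t : 𝕜) else 0 := b.coef_sum' D (fun _ => (t : 𝕜))
  obtain ⟨z, hz, h3⟩ := h (x + d) Λ (by
    intro n hn k hk
    have hnD : n ∉ D := Finset.disjoint_left.1 hED (hΛ hn)
    have : ‖b.f n (x + d)‖ = ‖b.f n x‖ := by rw [map_add, hfd, if_neg hnD, add_zero]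
    rw [this]
    refine le_trans ?_ (h1 n hn)
    rw [map_add, hfd]
    split_ifs with hkD
    · rw [b.coef_zero' hx (by
        have := Finset.disjoint_right.1 hED hkD
        exact_mod_cast this)]
      simp [abs_of_nonneg ht]
    · rw [add_zero]; exact h2 k hk) D hcard (fun _ => (t : 𝕜))
  rw [← hd, add_sub_cancel_right] at h3
  have hzE : z ∈ Submodule.span 𝕜 (b.e '' (E : Set ℕ)) :=
    Submodule.span_mono (Set.image_mono (by exact_mod_cast hΛ)) hz
  have h4 := hg (x - z) (Submodule.sub_mem _ hx hzE) d hdD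
  have e : x - z + d = x + d - z := by abel
  rw [e] at h4
  have h5 : ‖d‖ ≤ ‖x + d - z‖ + ‖x - z‖ := by
    calc ‖d‖ = ‖(x + d - z) - (x - z)‖ := by congr 1; abel
      _ ≤ _ := norm_sub_le _ _
  nlinarith

lemma L2' (b : MBasis 𝕜 X) {ρ C : ℝ} (hρ : 1 ≤ ρ) (h : b.SemiGreedy C) {E D Λ : Finset ℕ}
    (hcard : Λ.card ≤ D.card) (hED : Disjoint E D)
    (hg : ∀ x ∈ Submodule.span 𝕜 (b.e '' (E : Set ℕ)),
      ∀ z ∈ Submodule.span 𝕜 (b.e '' (D : Set ℕ)), ‖x‖ ≤ ρ * ‖x + z‖)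
    {t : ℝ} (ht : 0 ≤ t) {v u : X} (hv : v ∈ Submodule.span 𝕜 (b.e '' (E : Set ℕ)))
    (hu : u ∈ Submodule.span 𝕜 (b.e '' (Λ : Set ℕ)))
    (h2 : ∀ k, ‖b.f k v‖ ≤ t) :
    ‖v‖ ≤ ρ * C * ‖v + u + ∑ n ∈ D, (t : 𝕜) • b.e n‖ := by
  set d := ∑ n ∈ D, (t : 𝕜) • b.e n with hd
  have hdD : d ∈ Submodule.span 𝕜 (b.e '' (D : Set ℕ)) := b.sum_mem' D (fun _ => (t : 𝕜)) subset_rfl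
  have hfd : ∀ j, b.f j d = if j ∈ D then (t : 𝕜) else 0 := b.coef_sum' D (fun _ => (t : 𝕜))
  obtain ⟨z, hz, h3⟩ := h (v + d) D (by
    intro n hn k hk
    have hnE : b.f n v = 0 := b.coef_zero' hv (by
        have := Finset.disjoint_right.1 hED hn
        exact_mod_cast this)
    rw [map_add, map_add, hfd, hfd, if_pos hn, if_neg hk, hnE, add_zero, zero_add]
    simpa [abs_of_nonneg ht] using h2 k) Λ hcard (fun n => b.f n (-u))
  rw [← b.eq_sum' (Submodule.neg_mem _ hu)] at h3
  have h4 := hg v hv (d - z) (Submodule.sub_mem _ hdD hz)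
  have e : v + d - -u = v + u + d := by abel
  have e' : v + (d - z) = v + d - z := by abel
  rw [e] at h3
  rw [e'] at h4
  nlinarith

end MBasis

/-- A `ρ`-admissible `C_sg`-semi-greedy basis is disjoint-super-democratic with constant
at most `C_sg² ρ (1 + ρ)` and quasi-greedy with constant at most `C_sg ρ (1 + (1 + ρ) C_sg)`. -/
theorem stmt14 (b : MBasis 𝕜 X) (ρ : ℝ) (hρ : 1 ≤ ρ) (hadm : b.RhoAdmissible ρ)
    (Csg : ℝ) (h : b.SemiGreedy Csg) :
    b.DisjSuperDemocratic (Csg ^ 2 * ρ * (1 + ρ)) ∧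
      b.QuasiGreedy (Csg * ρ * (1 + (1 + ρ) * Csg)) := by
  have hC := b.one_le_C' h
  have hρC : 0 ≤ ρ * Csg := by positivity
  constructor
  · intro A B _ hAB ε ε' hε hε'
    obtain ⟨D, hDc, hED, hg⟩ := b.exists_good' hadm (A ∪ B) A.card
      (Finset.card_le_card Finset.subset_union_left)
    have hB := b.L1' hρ h hED Finset.subset_union_right (hDc.le.trans hAB) hg zero_le_one
      (x := b.indic ε' B) (b.sum_mem' B ε' (by simp))
      (fun n hn => by rw [indic, b.coef_sum', if_pos hn, hε'])
      (fun n hn => by rw [indic, b.coef_sum', if_neg hn]; simp)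
    have hA := b.L2' hρ h hDc.ge hED hg zero_le_one (v := b.indic ε A) (u := - b.indic ε A)
      (b.sum_mem' A ε (by simp)) (Submodule.neg_mem _ (b.sum_mem' A ε subset_rfl))
      (fun n => by
        rw [indic, b.coef_sum']
        split_ifs
        · exact (hε n).le
        · simp)
    rw [add_neg_cancel, zero_add] at hA
    calc _ ≤ _ := hA
      _ ≤ ρ * Csg * ((1 + ρ) * Csg * ‖b.indic ε' B‖) := by gcongr
      _ = _ := by ring
  · intro x Λ hΛ
    set P := b.proj Λ x with hP
    have hPs : P ∈ Submodule.span 𝕜 (b.e '' (Λ : Set ℕ)) := b.sum_mem' Λ _ subset_rfl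
    have hfP : ∀ j, b.f j P = if j ∈ Λ then b.f j x else 0 := b.coef_sum' Λ _
    set K := Csg * ρ * (1 + (1 + ρ) * Csg) with hK
    -- finite case
    have key : ∀ v ∈ Submodule.span 𝕜 (b.e '' ((Λ : Set ℕ)ᶜ)), ∀ u ∈
        Submodule.span 𝕜 (b.e '' (Λ : Set ℕ)), ∀ t : ℝ, 0 ≤ t → (∀ k, ‖b.f k v‖ ≤ t) →
        (∀ n ∈ Λ, t ≤ ‖b.f n u‖) → ‖v‖ ≤ K * ‖v + u‖ := by
      intro v hv u hu t ht hvt hut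
      obtain ⟨S, hS⟩ : ∃ S : Finset ℕ, v ∈ Submodule.span 𝕜 (b.e '' (S : Set ℕ)) := by
        classical
        obtain ⟨T, hT, hvT⟩ := Submodule.mem_span_finite_of_mem_span hv
        obtain ⟨S, -, hS⟩ := Finset.subset_set_image_iff.1 hT
        refine ⟨S, ?_⟩
        rw [← hS] at hvT
        simpa using hvT
      obtain ⟨D, hDc, hED, hg⟩ := b.exists_good' hadm (S ∪ Λ) Λ.card
        (Finset.card_le_card Finset.subset_union_right)
      have hvE : v ∈ Submodule.span 𝕜 (b.e '' ((S ∪ Λ : Finset ℕ) : Set ℕ)) :=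
        Submodule.span_mono (Set.image_mono (by simp)) hS
      have huE : u ∈ Submodule.span 𝕜 (b.e '' ((S ∪ Λ : Finset ℕ) : Set ℕ)) :=
        Submodule.span_mono (Set.image_mono (by simp)) hu
      have q1 := b.L1' hρ h hED Finset.subset_union_right hDc.le hg ht
        (Submodule.add_mem _ hvE huE)
        (fun n hn => by
          rw [map_add, b.coef_zero' hv (by simpa using hn), zero_add]; exact hut n hn)
        (fun n hn => by
          rw [map_add, b.coef_zero' hu (by simpa using hn), add_zero]; exact hvt n)
      have q2 := b.L2' hρ h hDc.ge hED hg ht hvE hu hvt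
      calc _ ≤ _ := q2
        _ ≤ ρ * Csg * (‖v + u‖ + (1 + ρ) * Csg * ‖v + u‖) := by
          gcongr
          exact (norm_add_le _ _).trans (by gcongr)
        _ = _ := by rw [hK]; ring
    set w := x - P with hw
    have hfw : ∀ j, b.f j w = if j ∈ Λ then 0 else b.f j x := by
      intro j
      rw [hw, map_sub, hfP]
      split_ifs <;> simp
    have hwc : w ∈ closure (Submodule.span 𝕜 (b.e '' ((Λ : Set ℕ)ᶜ)) : Set X) := by
      rw [b.strong]
      intro j hj
      rw [hfw, if_pos (by simpa using hj)]
    have hK0 : 0 ≤ K := by positivity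
    have hc2 : 0 ≤ b.c₂ := (norm_nonneg _).trans (b.e_le_c₂ 0)
    obtain ⟨α, hα0, hα1, hα2⟩ : ∃ α : ℝ, 0 ≤ α ∧ (∀ n ∈ Λ, α ≤ ‖b.f n x‖) ∧
        (∀ k ∉ Λ, ‖b.f k x‖ ≤ α) := by
      rcases Λ.eq_empty_or_nonempty with h0 | h0
      · refine ⟨b.c₂ * ‖x‖, by positivity, by simp [h0], fun k _ => ?_⟩
        exact (b.f k).le_of_opNorm_le (b.f_le_c₂ k) x
      · obtain ⟨m, hm, hmin⟩ := Λ.exists_min_image (fun n => ‖b.f n x‖) h0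
        exact ⟨_, norm_nonneg _, hmin, hΛ m hm⟩
    rcases hα0.eq_or_lt with h0 | hpos
    · have : w = 0 := b.total _ fun j => by
        rw [hfw]
        split_ifs with hj
        · rfl
        · exact norm_le_zero_iff.1 (h0 ▸ hα2 j hj)
      rw [this, norm_zero]; positivity
    have hcl : IsClosed {v : X | ‖v‖ ≤ K * ‖v + ((1 + b.c₂ * ‖w - v‖ / α : ℝ) : 𝕜) • P‖} := by
      apply isClosed_le (by fun_prop)
      have : Continuous fun v : X => ((1 + b.c₂ * ‖w - v‖ / α : ℝ) : 𝕜) :=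
        RCLike.continuous_ofReal.comp (by fun_prop)
      fun_prop
    have hmem := closure_minimal (t := {v : X | ‖v‖ ≤ K * ‖v + ((1 + b.c₂ * ‖w - v‖ / α : ℝ) : 𝕜) • P‖}) (fun v hv => by
      refine key v hv _ (Submodule.smul_mem _ _ hPs) (α + b.c₂ * ‖w - v‖) (by positivity) ?_ ?_
      · intro k
        have h1 : ‖b.f k (w - v)‖ ≤ b.c₂ * ‖w - v‖ := (b.f k).le_of_opNorm_le (b.f_le_c₂ k) _
        have h2 : ‖b.f k w‖ ≤ α := by
          rw [hfw]; split_ifs with hk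
          · simpa using hα0
          · exact hα2 k hk
        calc ‖b.f k v‖ = ‖b.f k w - b.f k (w - v)‖ := by rw [← map_sub, sub_sub_cancel]
          _ ≤ _ := (norm_sub_le _ _).trans (add_le_add h2 h1)
      · intro n hn
        have h3 : 0 ≤ 1 + b.c₂ * ‖w - v‖ / α := by positivity
        rw [map_smul, norm_smul, hfP, if_pos hn, RCLike.norm_ofReal, abs_of_nonneg h3]
        calc _ = (1 + b.c₂ * ‖w - v‖ / α) * α := by field_simp
          _ ≤ _ := by gcongr; exact hα1 n hn) hcl hwc
    have hmem' : ‖w‖ ≤ K * ‖w + ((1 + b.c₂ * ‖w - w‖ / α : ℝ) : 𝕜) • P‖ := hmem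
    simpa [hw] using hmem'
end
end

section
/- Let B be a basis of a Banach space X over 𝔽 and let w be a weight. If B is C_d-w-democratic and C_q-quasi-greedy, then B is C_s-w-super-democratic with C_s ≤ 4κ²C_qC_d, where κ = 1 if 𝔽 = ℝ and κ = 2 if 𝔽 = ℂ. -/
open scoped BigOperators NNReal

noncomputable section

theorem stmt15_convex {𝕜 : Type*} [RCLike 𝕜] {X : Type*} [NormedAddCommGroup X]
    [NormedSpace 𝕜 X] (v : ℕ → X) (t : ℕ → ℝ) (h0 : ∀ n, 0 ≤ t n) (h1 : ∀ n, t n ≤ 1)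
    (M : ℝ) (S : Finset ℕ) :
    ∀ u : X, (∀ A ⊆ S, ‖u + ∑ n ∈ A, v n‖ ≤ M) →
      ‖u + ∑ n ∈ S, ((t n : ℝ) : 𝕜) • v n‖ ≤ M := by
  induction S using Finset.induction_on with
  | empty => intro u h; simpa using h ∅ (by simp)
  | insert a S ha ih =>
    intro u h
    have hA := ih u (fun A hA => h A (hA.trans (Finset.subset_insert a S)))
    have hB := ih (u + v a) (fun A hA => by
      have := h (insert a A) (Finset.insert_subset_insert a hA)
      rwa [Finset.sum_insert (fun h => ha (hA h)), ← add_assoc] at this)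
    rw [Finset.sum_insert ha]
    set s := ∑ n ∈ S, ((t n : ℝ) : 𝕜) • v n
    have e : u + (((t a : ℝ) : 𝕜) • v a + s)
        = ((1 - t a : ℝ) : 𝕜) • (u + s) + ((t a : ℝ) : 𝕜) • (u + v a + s) := by
      push_cast
      module
    rw [e]
    refine (norm_add_le _ _).trans ?_
    rw [norm_smul, norm_smul, RCLike.norm_ofReal, RCLike.norm_ofReal,
      abs_of_nonneg (h0 a), abs_of_nonneg (sub_nonneg.2 (h1 a))]
    nlinarith [h0 a, h1 a, mul_le_mul_of_nonneg_left hA (sub_nonneg.2 (h1 a)),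
      mul_le_mul_of_nonneg_left hB (h0 a)]

theorem stmt15_real {𝕜 : Type*} [RCLike 𝕜] {X : Type*} [NormedAddCommGroup X]
    [NormedSpace 𝕜 X] (v : ℕ → X) (t : ℕ → ℝ) (h1 : ∀ n, |t n| ≤ 1)
    (M : ℝ) (S : Finset ℕ) (h : ∀ A ⊆ S, ‖∑ n ∈ A, v n‖ ≤ M) :
    ‖∑ n ∈ S, ((t n : ℝ) : 𝕜) • v n‖ ≤ 2 * M := by
  have hp := stmt15_convex (𝕜 := 𝕜) v (fun n => max (t n) 0) (fun n => le_max_right _ _)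
    (fun n => max_le (le_of_abs_le (h1 n)) zero_le_one) M S 0 (by simpa using h)
  have hm := stmt15_convex (𝕜 := 𝕜) v (fun n => max (-t n) 0) (fun n => le_max_right _ _)
    (fun n => max_le (neg_le_of_abs_le (h1 n) |> fun h => by linarith) zero_le_one) M S 0
    (by simpa using h)
  rw [zero_add] at hp hm
  have e : ∑ n ∈ S, ((t n : ℝ) : 𝕜) • v n
      = ∑ n ∈ S, ((max (t n) 0 : ℝ) : 𝕜) • v n
        - ∑ n ∈ S, ((max (-t n) 0 : ℝ) : 𝕜) • v n := by
    rw [← Finset.sum_sub_distrib]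
    refine Finset.sum_congr rfl fun n _ => ?_
    rw [← sub_smul, ← RCLike.ofReal_sub]
    congr 2
    rcases le_total 0 (t n) with h | h
    · rw [max_eq_left h, max_eq_right (by linarith)]; ring
    · rw [max_eq_right h, max_eq_left (by linarith)]; ring
  rw [e]
  linarith [norm_sub_le (∑ n ∈ S, ((max (t n) 0 : ℝ) : 𝕜) • v n)
    (∑ n ∈ S, ((max (-t n) 0 : ℝ) : 𝕜) • v n)]

theorem stmt15_scalar {𝕜 : Type*} [RCLike 𝕜] {X : Type*} [NormedAddCommGroup X]
    [NormedSpace 𝕜 X] (v : ℕ → X) (a : ℕ → 𝕜) (h1 : ∀ n, ‖a n‖ ≤ 1)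
    (M : ℝ) (S : Finset ℕ) (h : ∀ A ⊆ S, ‖∑ n ∈ A, v n‖ ≤ M) :
    ‖∑ n ∈ S, a n • v n‖ ≤ 2 * kappa 𝕜 * M := by
  have hr := stmt15_real (𝕜 := 𝕜) v (fun n => RCLike.re (a n))
    (fun n => (RCLike.abs_re_le_norm _).trans (h1 n)) M S h
  have hi := stmt15_real (𝕜 := 𝕜) v (fun n => RCLike.im (a n))
    (fun n => (RCLike.abs_im_le_norm _).trans (h1 n)) M S h
  have e : ∑ n ∈ S, a n • v n = ∑ n ∈ S, ((RCLike.re (a n) : ℝ) : 𝕜) • v n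
      + (RCLike.I : 𝕜) • ∑ n ∈ S, ((RCLike.im (a n) : ℝ) : 𝕜) • v n := by
    rw [Finset.smul_sum, ← Finset.sum_add_distrib]
    refine Finset.sum_congr rfl fun n _ => ?_
    rw [smul_smul, ← add_smul, mul_comm, RCLike.re_add_im]
  rw [e]
  unfold kappa
  split_ifs with hI
  · rw [hI, zero_smul, add_zero]; linarith
  · refine (norm_add_le _ _).trans ?_
    rw [norm_smul, RCLike.norm_I_of_ne_zero hI, one_mul]
    linarith

theorem stmt15_qg {𝕜 : Type*} [RCLike 𝕜] {X : Type*} [NormedAddCommGroup X]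
    [NormedSpace 𝕜 X] (b : MBasis 𝕜 X) (Cq : ℝ) (hq : b.QuasiGreedy Cq)
    (ε : ℕ → 𝕜) (hε : MBasis.IsSign ε) (B A : Finset ℕ) (hA : A ⊆ B) :
    ‖∑ n ∈ A, ε n • b.e n‖ ≤ Cq * ‖b.indic ε B‖ := by
  have hf : ∀ k, b.f k (b.indic ε B) = if k ∈ B then ε k else 0 := by
    intro k
    simp [MBasis.indic, map_sum, b.biorth]
  have := hq (b.indic ε B) (B \ A) (by
    intro n hn k _
    rw [hf, hf, if_pos (Finset.mem_sdiff.1 hn).1, hε n]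
    split_ifs
    · exact (hε k).le
    · simp)
  have e : b.proj (B \ A) (b.indic ε B) = ∑ n ∈ B \ A, ε n • b.e n := by
    unfold MBasis.proj
    refine Finset.sum_congr rfl fun n hn => ?_
    rw [hf, if_pos (Finset.mem_sdiff.1 hn).1]
  rw [e] at this
  have e2 : b.indic ε B - ∑ n ∈ B \ A, ε n • b.e n = ∑ n ∈ A, ε n • b.e n := by
    unfold MBasis.indic
    rw [← Finset.sum_sdiff hA]; abel
  rwa [e2] at this


variable {𝕜 : Type*} [RCLike 𝕜] {X : Type*} [NormedAddCommGroup X] [NormedSpace 𝕜 X]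
  [CompleteSpace X]

open MBasis

/-- If `B` is `C_d`-`w`-democratic and `C_q`-quasi-greedy, then `B` is
`w`-super-democratic with constant at most `4 κ² C_q C_d`. -/
theorem stmt15 (b : MBasis 𝕜 X) (w : ℕ → ℝ) (hw : ∀ n, 0 < w n) (Cd Cq : ℝ)
    (hd : b.WDemocratic w Cd) (hq : b.QuasiGreedy Cq) :
    b.WSuperDemocratic w (4 * kappa 𝕜 ^ 2 * Cq * Cd) := by
  intro A B hAB ε ε' hε hε'
  have hCd : 0 ≤ Cd := by
    have h := hd {0} {0} le_rfl
    simp only [Finset.sum_singleton] at h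
    have h0 := b.c₁_pos.trans_le (b.c₁_le_e 0)
    by_contra hc
    nlinarith
  have hk : 0 ≤ kappa 𝕜 := by unfold kappa; split_ifs <;> norm_num
  have hA : ‖b.indic ε A‖ ≤ 2 * kappa 𝕜 * (Cd * ‖∑ n ∈ B, b.e n‖) := by
    refine stmt15_scalar b.e ε (fun n => (hε n).le) _ A fun A' hA' => hd A' B ?_
    refine le_trans ?_ hAB
    exact Finset.sum_le_sum_of_subset_of_nonneg hA' fun n _ _ => (hw n).le
  have hB : ‖∑ n ∈ B, b.e n‖ ≤ 2 * kappa 𝕜 * (Cq * ‖b.indic ε' B‖) := by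
    have h := stmt15_scalar (fun n => ε' n • b.e n) (fun n => (ε' n)⁻¹)
      (fun n => by rw [norm_inv, hε' n, inv_one]) _ B
      (fun A' hA' => stmt15_qg b Cq hq ε' hε' B A' hA')
    have e : ∑ n ∈ B, (ε' n)⁻¹ • ε' n • b.e n = ∑ n ∈ B, b.e n := by
      refine Finset.sum_congr rfl fun n _ => ?_
      have : ε' n ≠ 0 := fun h0 => by simpa [h0] using hε' n
      rw [inv_smul_smul₀ this]
    rwa [e] at h
  calc ‖b.indic ε A‖ ≤ 2 * kappa 𝕜 * (Cd * ‖∑ n ∈ B, b.e n‖) := hA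
    _ ≤ 2 * kappa 𝕜 * (Cd * (2 * kappa 𝕜 * (Cq * ‖b.indic ε' B‖))) := by gcongr
    _ = _ := by ring
end
end
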